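/- arXiv:1810.08345 — 7 statements merged into one kernel-verified Lean document; each statement's English description precedes it below -/
import Mathlib

section
/- For every n ≥ 2^{64} there exists a connected unweighted graph G on n vertices with the following property: if T is a uniform random spanning tree of G and L_T is its inverse-leverage-score-weighted Laplacian, then with probability at least 1 − e^{−n^{0.4}}, L_T ⋠ (log n / (8·log log n))·L_G, i.e. the matrix (log n / (8·log log n))·L_G − L_T is not positive semidefinite. -/
open Matrix Finset
attribute [local instance] Classical.propDecidable

noncomputable section

/-- Spectral norm expressed as the supremum of |xᵀAx| over unit vectors
(this agrees with the operator norm for symmetric matrices). -/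
def specNorm {n : ℕ} (A : Matrix (Fin n) (Fin n) ℝ) : ℝ :=
  sSup { r | ∃ x : Fin n → ℝ, x ⬝ᵥ x = 1 ∧ |x ⬝ᵥ A.mulVec x| = r }

/-- A distribution on {0,1}^m is k-homogeneous if every support vector has exactly k ones. -/
def kHomogeneous (m k : ℕ) (π : (Fin m → Bool) → ℝ) : Prop :=
  ∀ ξ, π ξ ≠ 0 → (Finset.univ.filter fun i => ξ i = true).card = k

/-- A distribution on {0,1}^m is Strongly Rayleigh if its generating polynomial
has no root with all coordinates of positive imaginary part. -/
def StronglyRayleigh (m : ℕ) (π : (Fin m → Bool) → ℝ) : Prop :=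
  ∀ z : Fin m → ℂ, (∀ i, 0 < (z i).im) →
    (∑ ξ : Fin m → Bool, (π ξ : ℂ) * ∏ i ∈ Finset.univ.filter (fun i => ξ i = true), z i) ≠ 0

/-- The rank-one matrix b_e b_eᵀ for an edge e = {u,v}, where b_e = 1_u - 1_v. -/
def edgeMat (n : ℕ) (e : Sym2 (Fin n)) : Matrix (Fin n) (Fin n) ℝ :=
  fun i j => (if i = j ∧ i ∈ e then 1 else 0) + (if i ≠ j ∧ i ∈ e ∧ j ∈ e then -1 else 0)

/-- Weighted graph Laplacian. -/
def lap (n : ℕ) (G : SimpleGraph (Fin n)) (w : Sym2 (Fin n) → ℝ) : Matrix (Fin n) (Fin n) ℝ :=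
  ∑ e : Sym2 (Fin n), (if e ∈ G.edgeSet then w e else 0) • edgeMat n e

/-- T is a spanning tree of G: its edges lie in G, it is (spanning) connected,
and it has n - 1 edges. -/
def IsSpanningTree (n : ℕ) (G : SimpleGraph (Fin n)) (T : Finset (Sym2 (Fin n))) : Prop :=
  ↑T ⊆ G.edgeSet ∧ (SimpleGraph.fromEdgeSet (↑T : Set (Sym2 (Fin n)))).Connected ∧
    T.card = n - 1

/-- Product of edge weights of a tree. -/
def treeWt (n : ℕ) (w : Sym2 (Fin n) → ℝ) (T : Finset (Sym2 (Fin n))) : ℝ := ∏ e ∈ T, w e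

/-- w-uniform spanning tree distribution: Pr[T] ∝ ∏_{e ∈ T} w_e. -/
def treeProb (n : ℕ) (G : SimpleGraph (Fin n)) (w : Sym2 (Fin n) → ℝ)
    (T : Finset (Sym2 (Fin n))) : ℝ :=
  (if IsSpanningTree n G T then treeWt n w T else 0) /
    ∑ T' ∈ Finset.univ.filter (fun T' => IsSpanningTree n G T'), treeWt n w T'

/-- Leverage score of an edge: marginal probability of appearing in the random spanning tree. -/
def lev (n : ℕ) (G : SimpleGraph (Fin n)) (w : Sym2 (Fin n) → ℝ) (e : Sym2 (Fin n)) : ℝ :=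
  ∑ T ∈ Finset.univ.filter (fun T => IsSpanningTree n G T ∧ e ∈ T), treeProb n G w T

/-- Inverse-leverage-score-weighted Laplacian of a tree. -/
def treeLap (n : ℕ) (G : SimpleGraph (Fin n)) (w : Sym2 (Fin n) → ℝ)
    (T : Finset (Sym2 (Fin n))) : Matrix (Fin n) (Fin n) ℝ :=
  ∑ e ∈ T, (w e / lev n G w e) • edgeMat n e


/-! Windmill graphs: cliques glued at a root `r`; blocks are the fibres of `blk`. -/

/-- The non-root vertices of block `i`. -/
def wB {n : ℕ} (r : Fin n) (blk : Fin n → Fin n) (i : Fin n) : Finset (Fin n) :=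
  Finset.univ.filter (fun v => v ≠ r ∧ blk v = i)

/-- The retraction onto block `i` together with the root. -/
def wPh {n : ℕ} (r : Fin n) (blk : Fin n → Fin n) (i : Fin n) (v : Fin n) : Fin n :=
  if v ≠ r ∧ blk v = i then v else r

/-- The windmill graph. -/
def wG {n : ℕ} (r : Fin n) (blk : Fin n → Fin n) : SimpleGraph (Fin n) where
  Adj a b := a ≠ b ∧ (a = r ∨ b = r ∨ blk a = blk b)
  symm := ⟨by
    rintro a b ⟨h1, h2⟩
    refine ⟨h1.symm, ?_⟩
    rcases h2 with h | h | h
    · exact Or.inr (Or.inl h)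
    · exact Or.inl h
    · exact Or.inr (Or.inr h.symm)⟩
  loopless := ⟨fun a h => h.1 rfl⟩

/-- Edges of block `i`. -/
def wE {n : ℕ} (r : Fin n) (blk : Fin n → Fin n) (i : Fin n) : Finset (Sym2 (Fin n)) :=
  Finset.univ.filter (fun e => ¬ e.IsDiag ∧ ∀ v ∈ e, v = r ∨ blk v = i)

/-- Spanning trees of block `i`. -/
def wGood {n : ℕ} (r : Fin n) (blk : Fin n → Fin n) (i : Fin n) (A : Finset (Sym2 (Fin n))) :
    Prop :=
  A ⊆ wE r blk i ∧
    (∀ v ∈ wB r blk i, (SimpleGraph.fromEdgeSet (↑A : Set (Sym2 (Fin n)))).Reachable r v) ∧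
    A.card = (wB r blk i).card

/-- Star at `v` in block `i`. -/
def wStar {n : ℕ} (r : Fin n) (blk : Fin n → Fin n) (i v : Fin n) : Finset (Sym2 (Fin n)) :=
  (wE r blk i).filter (fun e => v ∈ e)

section windmill
variable {n : ℕ} {r : Fin n} {blk : Fin n → Fin n}

lemma wE_mk {i a b : Fin n} : s(a, b) ∈ wE r blk i ↔
    a ≠ b ∧ (a = r ∨ blk a = i) ∧ (b = r ∨ blk b = i) := by
  simp [wE]

lemma wG_exists {e : Sym2 (Fin n)} (he : e ∈ (wG r blk).edgeSet) : ∃ i, e ∈ wE r blk i := by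
  induction e with
  | _ a b =>
    rw [SimpleGraph.mem_edgeSet] at he
    obtain ⟨h1, h2⟩ := he
    simp only [wE_mk]
    rcases h2 with h | h | h
    · exact ⟨blk b, h1, Or.inl h, Or.inr rfl⟩
    · exact ⟨blk a, h1, Or.inr rfl, Or.inl h⟩
    · exact ⟨blk a, h1, Or.inr rfl, Or.inr h.symm⟩

lemma wE_sub {i : Fin n} {e : Sym2 (Fin n)} (he : e ∈ wE r blk i) : e ∈ (wG r blk).edgeSet := by
  induction e with
  | _ a b =>
    rw [wE_mk] at he
    rw [SimpleGraph.mem_edgeSet]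
    refine ⟨he.1, ?_⟩
    rcases he.2 with ⟨h | h, h' | h'⟩
    · exact Or.inl h
    · exact Or.inl h
    · exact Or.inr (Or.inl h')
    · exact Or.inr (Or.inr (h.trans h'.symm))

lemma wE_unique {i j : Fin n} {e : Sym2 (Fin n)} (hi : e ∈ wE r blk i) (hj : e ∈ wE r blk j) :
    i = j := by
  induction e with
  | _ a b =>
    rw [wE_mk] at hi hj
    grind

lemma reach_map {T A : Finset (Sym2 (Fin n))} {f : Fin n → Fin n}
    (h : ∀ a b, s(a, b) ∈ T → f a = f b ∨ s(f a, f b) ∈ A) {u v : Fin n}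
    (huv : (SimpleGraph.fromEdgeSet (↑T : Set (Sym2 (Fin n)))).Reachable u v) :
    (SimpleGraph.fromEdgeSet (↑A : Set (Sym2 (Fin n)))).Reachable (f u) (f v) := by
  rw [SimpleGraph.reachable_iff_reflTransGen] at huv
  induction huv with
  | refl => exact SimpleGraph.Reachable.refl _
  | tail _ hbc ih =>
    rename_i b c _
    refine ih.trans ?_
    rw [SimpleGraph.fromEdgeSet_adj] at hbc
    by_cases hf : f b = f c
    · rw [hf]
    · rcases h b c (by simpa using hbc.1) with h1 | h1
      · exact absurd h1 hf
      · refine SimpleGraph.Adj.reachable ?_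
        rw [SimpleGraph.fromEdgeSet_adj]
        exact ⟨by simpa using h1, hf⟩

lemma conn_of_reach {T : Finset (Sym2 (Fin n))}
    (h : ∀ v, (SimpleGraph.fromEdgeSet (↑T : Set (Sym2 (Fin n)))).Reachable r v) :
    (SimpleGraph.fromEdgeSet (↑T : Set (Sym2 (Fin n)))).Connected := by
  have : Nonempty (Fin n) := ⟨r⟩
  exact ⟨fun a b => (h a).symm.trans (h b)⟩

lemma card_ge_of_conn {T : Finset (Sym2 (Fin n))}
    (h : (SimpleGraph.fromEdgeSet (↑T : Set (Sym2 (Fin n)))).Connected) : n ≤ T.card + 1 := by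
  have h1 := h.card_vert_le_card_edgeSet_add_one
  rw [Nat.card_fin] at h1
  have h2 : Nat.card ↑(SimpleGraph.fromEdgeSet (↑T : Set (Sym2 (Fin n)))).edgeSet ≤ T.card := by
    rw [SimpleGraph.edgeSet_fromEdgeSet, Nat.card_coe_set_eq]
    calc _ ≤ (↑T : Set (Sym2 (Fin n))).ncard := Set.ncard_le_ncard Set.sdiff_subset (Finset.finite_toSet T)
      _ = T.card := Set.ncard_coe_finset T
  omega

lemma wB_mem {i v : Fin n} : v ∈ wB r blk i ↔ v ≠ r ∧ blk v = i := by simp [wB]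

lemma wB_sum : ∑ i, (wB r blk i).card = n - 1 := by
  have h := Finset.card_eq_sum_card_fiberwise (f := blk) (s := Finset.univ.filter (fun v => v ≠ r))
    (t := Finset.univ) (fun _ _ => by simp)
  have h2 : (Finset.univ.filter (fun v : Fin n => v ≠ r)).card = n - 1 := by
    rw [Finset.filter_ne', Finset.card_erase_of_mem (Finset.mem_univ _)]; simp
  rw [h2] at h
  rw [h]
  refine Finset.sum_congr rfl fun i _ => ?_
  congr 1
  ext v
  simp [wB]

lemma card_ge_of_reach {i : Fin n} {A : Finset (Sym2 (Fin n))}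
    (h : ∀ v ∈ wB r blk i, (SimpleGraph.fromEdgeSet (↑A : Set (Sym2 (Fin n)))).Reachable r v) :
    (wB r blk i).card ≤ A.card := by
  set C : Finset (Sym2 (Fin n)) := ((wB r blk i)ᶜ.erase r).image (fun v => s(r, v)) with hC
  have hconn : (SimpleGraph.fromEdgeSet (↑(A ∪ C) : Set (Sym2 (Fin n)))).Connected := by
    apply conn_of_reach (r := r)
    intro v
    by_cases hv : v ∈ wB r blk i
    · exact (h v hv).mono (SimpleGraph.fromEdgeSet_mono (by simp))
    · by_cases hr : v = r
      · subst hr; exact SimpleGraph.Reachable.refl _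
      · refine SimpleGraph.Adj.reachable ?_
        rw [SimpleGraph.fromEdgeSet_adj]
        refine ⟨?_, Ne.symm hr⟩
        rw [Finset.mem_coe, Finset.mem_union]
        right
        rw [hC, Finset.mem_image]
        exact ⟨v, by simp [hr, hv], rfl⟩
  have h1 := card_ge_of_conn hconn
  have h2 := Finset.card_union_le A C
  have h3 : C.card ≤ ((wB r blk i)ᶜ.erase r).card := Finset.card_image_le
  have hr : r ∈ (wB r blk i)ᶜ := by simp [wB]
  rw [Finset.card_erase_of_mem hr, Finset.card_compl, Fintype.card_fin] at h3
  have h4 : (wB r blk i).card < n := by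
    have := Finset.card_lt_univ_of_notMem (s := wB r blk i) (x := r) (by simp [wB])
    simpa using this
  omega

lemma split_union {T : Finset (Sym2 (Fin n))} (hT : (↑T : Set (Sym2 (Fin n))) ⊆ (wG r blk).edgeSet) :
    Finset.univ.biUnion (fun i => T ∩ wE r blk i) = T := by
  ext e
  simp only [Finset.mem_biUnion, Finset.mem_univ, true_and, Finset.mem_inter]
  constructor
  · rintro ⟨i, h, _⟩; exact h
  · intro h
    obtain ⟨i, hi⟩ := wG_exists (hT h)
    exact ⟨i, h, hi⟩

lemma card_union {f : Fin n → Finset (Sym2 (Fin n))} (hf : ∀ i, f i ⊆ wE r blk i) :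
    (Finset.univ.biUnion f).card = ∑ i, (f i).card := by
  apply Finset.card_biUnion
  intro i _ j _ hij
  refine Finset.disjoint_left.2 ?_
  intro e h1 h2
  exact hij (wE_unique (hf i h1) (hf j h2))

lemma union_inter {f : Fin n → Finset (Sym2 (Fin n))} (hf : ∀ i, f i ⊆ wE r blk i) (j : Fin n) :
    Finset.univ.biUnion f ∩ wE r blk j = f j := by
  ext e
  simp only [Finset.mem_biUnion, Finset.mem_univ, true_and, Finset.mem_inter]
  constructor
  · rintro ⟨⟨i, h⟩, h2⟩
    rw [wE_unique h2 (hf i h)]; exact h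
  · intro h; exact ⟨⟨j, h⟩, hf j h⟩

lemma good_of_tree {T : Finset (Sym2 (Fin n))} (hT : IsSpanningTree n (wG r blk) T) (i : Fin n) :
    wGood r blk i (T ∩ wE r blk i) := by
  obtain ⟨hsub, hconn, hcard⟩ := hT
  have hreach : ∀ i, ∀ v ∈ wB r blk i,
      (SimpleGraph.fromEdgeSet (↑(T ∩ wE r blk i) : Set (Sym2 (Fin n)))).Reachable r v := by
    intro i v hv
    have h := reach_map (T := T) (A := T ∩ wE r blk i) (f := wPh r blk i) (u := r) (v := v) ?_
      (hconn.preconnected r v)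
    · rw [wB_mem] at hv
      simpa [wPh, hv] using h
    · intro a b hab
      have hG := hsub hab
      rw [SimpleGraph.mem_edgeSet] at hG
      obtain ⟨h1, h2⟩ := hG
      simp only [Finset.mem_inter, wE_mk]
      unfold wPh
      have hba : s(b, a) ∈ T := by rw [Sym2.eq_swap]; exact hab
      by_cases ha : a = r <;> by_cases hb : b = r <;> by_cases ha' : blk a = i <;>
        by_cases hb' : blk b = i <;> simp_all
  refine ⟨Finset.inter_subset_right, hreach i, ?_⟩
  have hge : ∀ j ∈ Finset.univ, (wB r blk j).card ≤ (T ∩ wE r blk j).card :=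
    fun j _ => card_ge_of_reach (hreach j)
  have hsum : ∑ j, (wB r blk j).card = ∑ j, (T ∩ wE r blk j).card := by
    rw [wB_sum, ← hcard, ← card_union (r := r) (blk := blk) (fun i => Finset.inter_subset_right), split_union hsub]
  exact ((Finset.sum_eq_sum_iff_of_le hge).1 hsum i (Finset.mem_univ _)).symm

lemma tree_of_good {f : Fin n → Finset (Sym2 (Fin n))} (hf : ∀ i, wGood r blk i (f i)) :
    IsSpanningTree n (wG r blk) (Finset.univ.biUnion f) := by
  refine ⟨?_, ?_, ?_⟩
  · intro e he
    simp only [Finset.coe_biUnion, Set.mem_iUnion] at he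
    obtain ⟨i, _, hi⟩ := he
    exact wE_sub ((hf i).1 hi)
  · apply conn_of_reach (r := r)
    intro v
    by_cases hv : v = r
    · subst hv; exact SimpleGraph.Reachable.refl _
    · refine ((hf (blk v)).2.1 v (wB_mem.2 ⟨hv, rfl⟩)).mono (SimpleGraph.fromEdgeSet_mono ?_)
      exact_mod_cast Finset.subset_biUnion_of_mem f (Finset.mem_univ (blk v))
  · rw [card_union (fun i => (hf i).1), ← wB_sum (r := r) (blk := blk)]
    exact Finset.sum_congr rfl fun i _ => (hf i).2.2

lemma wStar_card {i v : Fin n} (hv : v ∈ insert r (wB r blk i)) :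
    (wStar r blk i v).card = (wB r blk i).card := by
  have h1 : wStar r blk i v = ((insert r (wB r blk i)).erase v).image (fun u => s(v, u)) := by
    ext e
    induction e with
    | _ a b =>
      simp only [wStar, Finset.mem_filter, wE_mk, Finset.mem_image, Finset.mem_erase,
        Finset.mem_insert, wB_mem, Sym2.mem_iff] at hv ⊢
      constructor
      · rintro ⟨⟨h1, h2, h3⟩, h4 | h4⟩
        · subst h4
          exact ⟨b, ⟨Ne.symm h1, by tauto⟩, rfl⟩
        · subst h4
          exact ⟨a, ⟨h1, by tauto⟩, Sym2.eq_swap⟩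
      · rintro ⟨u, ⟨h1, h2⟩, h3⟩
        rw [Sym2.eq_iff] at h3
        rcases h3 with ⟨rfl, rfl⟩ | ⟨rfl, rfl⟩
        · exact ⟨⟨Ne.symm h1, by tauto, by tauto⟩, Or.inl rfl⟩
        · exact ⟨⟨h1, by tauto, by tauto⟩, Or.inr rfl⟩
  rw [h1, Finset.card_image_of_injective, Finset.card_erase_of_mem hv,
    Finset.card_insert_of_notMem (by simp [wB])]
  · simp
  · intro a b hab
    exact Sym2.congr_right.1 hab

lemma wStar_good {i v : Fin n} (hv : v ∈ insert r (wB r blk i)) :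
    wGood r blk i (wStar r blk i v) := by
  refine ⟨Finset.filter_subset _ _, ?_, wStar_card hv⟩
  have key : ∀ u ∈ insert r (wB r blk i),
      (SimpleGraph.fromEdgeSet (↑(wStar r blk i v) : Set (Sym2 (Fin n)))).Reachable v u := by
    intro u hu
    by_cases huv : v = u
    · rw [huv]
    · refine SimpleGraph.Adj.reachable ?_
      rw [SimpleGraph.fromEdgeSet_adj]
      refine ⟨?_, huv⟩
      simp only [Finset.mem_insert, wB_mem] at hu hv
      simp only [wStar, Finset.coe_filter, Set.mem_ofPred_eq, wE_mk, Sym2.mem_iff]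
      exact ⟨⟨huv, by tauto, by tauto⟩, by simp⟩
  intro u hu
  exact (key r (Finset.mem_insert_self _ _)).symm.trans (key u (Finset.mem_insert_of_mem hu))

/-- The set of spanning trees of block `i`. -/
def wS (r : Fin n) (blk : Fin n → Fin n) (i : Fin n) : Finset (Finset (Sym2 (Fin n))) :=
  Finset.univ.filter (fun A => wGood r blk i A)

/-- The set of spanning trees. -/
def wT (r : Fin n) (blk : Fin n → Fin n) : Finset (Finset (Sym2 (Fin n))) :=
  Finset.univ.filter (fun T => IsSpanningTree n (wG r blk) T)

lemma wT_card_ge : ∏ i, (wS r blk i).card ≤ (wT r blk).card := by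
  rw [← Fintype.card_piFinset]
  apply Finset.card_le_card_of_injOn (fun f => Finset.univ.biUnion f)
  · intro f hf
    simp only [Finset.mem_coe, Fintype.mem_piFinset, wS, Finset.mem_filter, Finset.mem_univ, true_and] at hf
    simp only [wT, Finset.coe_filter, Finset.mem_univ, true_and, Set.mem_ofPred_eq]
    exact tree_of_good hf
  · intro f hf g hg hfg
    simp only [Finset.mem_coe, Fintype.mem_piFinset, wS, Finset.mem_filter, Finset.mem_univ, true_and] at hf hg
    funext j
    rw [← union_inter (fun i => (hf i).1) j, ← union_inter (fun i => (hg i).1) j]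
    exact congrArg (· ∩ wE r blk j) hfg

lemma wS_pos (i : Fin n) : 0 < (wS r blk i).card := by
  apply Finset.card_pos.2
  exact ⟨wStar r blk i r, by simp only [wS, Finset.mem_filter, Finset.mem_univ, true_and]; exact wStar_good (by simp)⟩

lemma wT_pos : 0 < (wT r blk).card :=
  lt_of_lt_of_le (Finset.prod_pos fun i _ => wS_pos i) wT_card_ge

/-- Trees avoiding the given star in each of the blocks in `I`. -/
def wBad (r : Fin n) (blk : Fin n → Fin n) (I : Finset (Fin n)) (c : Fin n → Fin n) :
    Finset (Finset (Sym2 (Fin n))) :=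
  (wT r blk).filter (fun T => ∀ i ∈ I, T ∩ wE r blk i ≠ wStar r blk i (c i))

lemma wBad_card_le (I : Finset (Fin n)) (c : Fin n → Fin n)
    (hc : ∀ i ∈ I, c i ∈ insert r (wB r blk i)) :
    (wBad r blk I c).card ≤ ∏ i, ((wS r blk i).card - if i ∈ I then 1 else 0) := by
  have : ∀ i, ((wS r blk i).card - if i ∈ I then 1 else 0) =
      (if i ∈ I then (wS r blk i).erase (wStar r blk i (c i)) else wS r blk i).card := by
    intro i
    split_ifs with hi
    · rw [Finset.card_erase_of_mem]
      simp only [wS, Finset.mem_filter, Finset.mem_univ, true_and]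
      exact wStar_good (hc i hi)
    · rfl
  simp only [this]
  rw [← Fintype.card_piFinset]
  apply Finset.card_le_card_of_injOn (fun T i => T ∩ wE r blk i)
  · intro T hT
    simp only [Finset.mem_coe, wBad, wT, Finset.mem_filter, Finset.mem_univ, true_and] at hT
    simp only [Finset.mem_coe, Fintype.mem_piFinset]
    intro i
    have hg : T ∩ wE r blk i ∈ wS r blk i := by
      simp only [wS, Finset.mem_filter, Finset.mem_univ, true_and]
      exact good_of_tree hT.1 i
    split_ifs with hi
    · exact Finset.mem_erase.2 ⟨hT.2 i hi, hg⟩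
    · exact hg
  · intro T hT T' hT' h
    simp only [Finset.mem_coe, wBad, wT, Finset.mem_filter, Finset.mem_univ, true_and] at hT hT'
    rw [← split_union hT.1.1, ← split_union hT'.1.1]
    exact congrArg (fun f => Finset.univ.biUnion f) h

lemma wBad_ratio (I : Finset (Fin n)) (c : Fin n → Fin n) (M : ℝ)
    (hc : ∀ i ∈ I, c i ∈ insert r (wB r blk i))
    (hM : ∀ i ∈ I, ((wS r blk i).card : ℝ) ≤ M) :
    ((wBad r blk I c).card : ℝ) ≤ Real.exp (-(I.card / M)) * (wT r blk).card := by
  have h1 : ((wBad r blk I c).card : ℝ) ≤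
      ∏ i, ((if i ∈ I then Real.exp (-(1 / M)) else 1) * ((wS r blk i).card : ℝ)) := by
    refine le_trans (Nat.cast_le.2 (wBad_card_le I c hc)) ?_
    rw [Nat.cast_prod]
    refine Finset.prod_le_prod (fun _ _ => Nat.cast_nonneg _) fun i _ => ?_
    split_ifs with hi
    · have hp : (0 : ℝ) < (wS r blk i).card := Nat.cast_pos.2 (wS_pos i)
      rw [Nat.cast_sub (wS_pos i)]
      have h2 := Real.add_one_le_exp (-(1 / M))
      have h3 : 1 / M * ((wS r blk i).card : ℝ) ≤ 1 := by
        have hMp : 0 < M := lt_of_lt_of_le hp (hM i hi)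
        rw [one_div, inv_mul_le_iff₀ hMp, mul_one]; exact hM i hi
      push_cast
      nlinarith
    · simp
  refine h1.trans ?_
  rw [Finset.prod_mul_distrib]
  have h4 : ∏ i, (if i ∈ I then Real.exp (-(1 / M)) else 1) = Real.exp (-(I.card / M)) := by
    rw [Finset.prod_ite_mem, Finset.univ_inter, Finset.prod_const, ← Real.exp_nat_mul]
    congr 1; ring
  rw [h4]
  apply mul_le_mul_of_nonneg_left _ (Real.exp_pos _).le
  exact_mod_cast wT_card_ge

lemma wS_card_le (i : Fin n) :
    (wS r blk i).card ≤ (((wB r blk i).card + 1) ^ 2) ^ (wB r blk i).card := by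
  have h1 : wS r blk i ⊆ (wE r blk i).powersetCard (wB r blk i).card := by
    intro A hA
    simp only [wS, Finset.mem_filter, Finset.mem_univ, true_and] at hA
    exact Finset.mem_powersetCard.2 ⟨hA.1, hA.2.2⟩
  refine (Finset.card_le_card h1).trans ?_
  rw [Finset.card_powersetCard]
  refine (Nat.choose_le_pow _ _).trans (Nat.pow_le_pow_left ?_ _)
  have h2 : wE r blk i ⊆ ((insert r (wB r blk i)) ×ˢ (insert r (wB r blk i))).image
      (fun p => s(p.1, p.2)) := by
    intro e
    induction e with
    | _ a b =>
      rw [wE_mk, Finset.mem_image]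
      rintro ⟨_, h1, h2⟩
      refine ⟨(a, b), ?_, rfl⟩
      simp only [Finset.mem_product, Finset.mem_insert, wB_mem]
      tauto
  refine (Finset.card_le_card h2).trans (Finset.card_image_le.trans ?_)
  rw [Finset.card_product, Finset.card_insert_of_notMem (by simp [wB]), sq]

end windmill

section windmill2
variable {n : ℕ} {r : Fin n} {blk : Fin n → Fin n}

lemma treeProb_one (T : Finset (Sym2 (Fin n))) :
    treeProb n (wG r blk) 1 T =
      if IsSpanningTree n (wG r blk) T then 1 / ((wT r blk).card : ℝ) else 0 := by
  unfold treeProb treeWt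
  have : ∑ T' ∈ Finset.univ.filter (fun T' => IsSpanningTree n (wG r blk) T'),
      ∏ e ∈ T', (1 : Sym2 (Fin n) → ℝ) e = ((wT r blk).card : ℝ) := by
    simp [wT]
  rw [this]
  split_ifs <;> simp

lemma lev_eq (e : Sym2 (Fin n)) :
    lev n (wG r blk) 1 e = ∑ T ∈ wT r blk, if e ∈ T then 1 / ((wT r blk).card : ℝ) else 0 := by
  unfold lev
  rw [← Finset.sum_filter]
  have : Finset.univ.filter (fun T => IsSpanningTree n (wG r blk) T ∧ e ∈ T) =
      (wT r blk).filter (fun T => e ∈ T) := by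
    ext T; simp [wT]
  rw [this]
  refine Finset.sum_congr rfl fun T hT => ?_
  rw [treeProb_one, if_pos]
  simp only [wT, Finset.mem_filter, Finset.mem_univ, true_and] at hT
  exact hT.1

lemma lev_nonneg (e : Sym2 (Fin n)) : 0 ≤ lev n (wG r blk) 1 e := by
  rw [lev_eq]
  refine Finset.sum_nonneg fun T _ => ?_
  split_ifs <;> positivity

lemma lev_pos {e : Sym2 (Fin n)} {T : Finset (Sym2 (Fin n))}
    (hT : IsSpanningTree n (wG r blk) T) (he : e ∈ T) : 0 < lev n (wG r blk) 1 e := by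
  rw [lev_eq]
  have hp : (0 : ℝ) < (wT r blk).card := Nat.cast_pos.2 wT_pos
  refine Finset.sum_pos' (fun T _ => by split_ifs <;> positivity) ⟨T, ?_, ?_⟩
  · simpa [wT] using hT
  · rw [if_pos he]; positivity

lemma lev_sum (i : Fin n) :
    ∑ e ∈ wE r blk i, lev n (wG r blk) 1 e = (wB r blk i).card := by
  simp only [lev_eq]
  rw [Finset.sum_comm]
  have hp : (0 : ℝ) < (wT r blk).card := Nat.cast_pos.2 wT_pos
  have : ∀ T ∈ wT r blk, (∑ e ∈ wE r blk i, if e ∈ T then 1 / ((wT r blk).card : ℝ) else 0) =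
      (wB r blk i).card * (1 / ((wT r blk).card : ℝ)) := by
    intro T hT
    simp only [wT, Finset.mem_filter, Finset.mem_univ, true_and] at hT
    rw [Finset.sum_ite_mem, Finset.sum_const, nsmul_eq_mul, Finset.inter_comm,
      (good_of_tree hT i).2.2]
  rw [Finset.sum_congr rfl this, Finset.sum_const, nsmul_eq_mul]
  field_simp

lemma exists_center (i : Fin n) : ∃ v ∈ insert r (wB r blk i),
    ∑ e ∈ wStar r blk i v, lev n (wG r blk) 1 e ≤
      2 * ((wB r blk i).card : ℝ) / ((wB r blk i).card + 1) := by
  apply Finset.exists_le_of_sum_le (Finset.insert_nonempty _ _)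
  rw [Finset.sum_const, nsmul_eq_mul, Finset.card_insert_of_notMem (by simp [wB])]
  have h0 : (0 : ℝ) < (wB r blk i).card + 1 := by positivity
  push_cast
  rw [mul_div_cancel₀ _ h0.ne']
  simp only [wStar, Finset.sum_filter]
  rw [Finset.sum_comm, ← lev_sum i, Finset.mul_sum]
  refine Finset.sum_le_sum fun e _ => ?_
  rw [← Finset.sum_filter, Finset.sum_const, nsmul_eq_mul]
  refine mul_le_mul_of_nonneg_right ?_ (lev_nonneg e)
  have : (Finset.filter (fun v => v ∈ e) (insert r (wB r blk i))).card ≤ 2 := by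
    induction e with
    | _ a b =>
      refine le_trans (Finset.card_le_card (t := {a, b}) ?_) Finset.card_le_two
      intro v hv
      simpa using (Finset.mem_filter.1 hv).2
  exact_mod_cast this

lemma quad_edge (x : Fin n → ℝ) {a b : Fin n} (hab : a ≠ b) :
    x ⬝ᵥ (edgeMat n s(a, b)).mulVec x = (x a - x b) ^ 2 := by
  have h : edgeMat n s(a, b) =
      Matrix.vecMulVec (Pi.single a 1 - Pi.single b 1) (Pi.single a 1 - Pi.single b 1) := by
    ext i j
    simp only [edgeMat, Matrix.vecMulVec_apply, Pi.sub_apply, Pi.single_apply, Sym2.mem_iff]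
    by_cases h1 : i = a <;> by_cases h2 : i = b <;> by_cases h3 : j = a <;> by_cases h4 : j = b <;>
      by_cases h5 : i = j <;> simp_all
  rw [h, Matrix.vecMulVec_mulVec]
  simp [sub_dotProduct, dotProduct_sub]
  ring

/-- Test vector. -/
def wX (r : Fin n) (blk : Fin n → Fin n) (i v : Fin n) : Fin n → ℝ :=
  fun u => if wPh r blk i u = v then 1 else 0

lemma quad_wX {i v : Fin n} (hv : v ∈ insert r (wB r blk i)) {e : Sym2 (Fin n)}
    (he : e ∈ (wG r blk).edgeSet) :
    wX r blk i v ⬝ᵥ (edgeMat n e).mulVec (wX r blk i v) =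
      if e ∈ wStar r blk i v then 1 else 0 := by
  induction e with
  | _ a b =>
    rw [SimpleGraph.mem_edgeSet] at he
    obtain ⟨h1, h2⟩ := he
    rw [quad_edge _ h1]
    simp only [wStar, Finset.mem_filter, wE_mk, Sym2.mem_iff, wX, wPh]
    simp only [Finset.mem_insert, wB_mem] at hv
    by_cases ha : a = r <;> by_cases hb : b = r <;> by_cases ha' : blk a = i <;>
      by_cases hb' : blk b = i <;> by_cases hav : a = v <;> by_cases hbv : b = v <;>
      by_cases hr : v = r <;> simp_all <;> grind

lemma quad_lap {i v : Fin n} (hv : v ∈ insert r (wB r blk i)) :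
    wX r blk i v ⬝ᵥ (lap n (wG r blk) 1).mulVec (wX r blk i v) = (wB r blk i).card := by
  unfold lap
  rw [Matrix.sum_mulVec, dotProduct_sum]
  have : ∀ e ∈ (Finset.univ : Finset (Sym2 (Fin n))), wX r blk i v ⬝ᵥ
      ((if e ∈ (wG r blk).edgeSet then (1 : Sym2 (Fin n) → ℝ) e else 0) • edgeMat n e).mulVec
        (wX r blk i v) = if e ∈ wStar r blk i v then 1 else 0 := by
    intro e _
    rw [Matrix.smul_mulVec, dotProduct_smul]
    split_ifs with h1 h2 h2
    · rw [quad_wX hv h1, if_pos h2]; simp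
    · rw [quad_wX hv h1, if_neg h2]; simp
    · exact absurd (wE_sub (Finset.mem_filter.1 h2).1) h1
    · simp
  rw [Finset.sum_congr rfl this, Finset.sum_ite_mem, Finset.univ_inter, Finset.sum_const,
    wStar_card hv]
  simp

lemma quad_treeLap {i v : Fin n} (hv : v ∈ insert r (wB r blk i)) {T : Finset (Sym2 (Fin n))}
    (hT : IsSpanningTree n (wG r blk) T) (hs : T ∩ wE r blk i = wStar r blk i v) :
    wX r blk i v ⬝ᵥ (treeLap n (wG r blk) 1 T).mulVec (wX r blk i v) =
      ∑ e ∈ wStar r blk i v, 1 / lev n (wG r blk) 1 e := by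
  unfold treeLap
  rw [Matrix.sum_mulVec, dotProduct_sum]
  have : ∀ e ∈ T, wX r blk i v ⬝ᵥ
      (((1 : Sym2 (Fin n) → ℝ) e / lev n (wG r blk) 1 e) • edgeMat n e).mulVec
        (wX r blk i v) = if e ∈ wStar r blk i v then 1 / lev n (wG r blk) 1 e else 0 := by
    intro e he
    rw [Matrix.smul_mulVec, dotProduct_smul, quad_wX hv (hT.1 he)]
    split_ifs <;> simp
  rw [Finset.sum_congr rfl this, Finset.sum_ite_mem]
  congr 1
  rw [← hs]
  ext e; simp

lemma not_psd {i v : Fin n} (hv : v ∈ insert r (wB r blk i)) {T : Finset (Sym2 (Fin n))}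
    (hT : IsSpanningTree n (wG r blk) T) (hs : T ∩ wE r blk i = wStar r blk i v)
    (hl : ∑ e ∈ wStar r blk i v, lev n (wG r blk) 1 e ≤
      2 * ((wB r blk i).card : ℝ) / ((wB r blk i).card + 1))
    (h1 : 0 < (wB r blk i).card) {c : ℝ} (hc : 2 * c < (wB r blk i).card + 1) :
    ¬ (c • lap n (wG r blk) 1 - treeLap n (wG r blk) 1 T).PosSemidef := by
  intro hpsd
  have h := hpsd.dotProduct_mulVec_nonneg (wX r blk i v)
  rw [star_trivial, Matrix.sub_mulVec, dotProduct_sub, Matrix.smul_mulVec, dotProduct_smul,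
    quad_lap hv, quad_treeLap hv hT hs, smul_eq_mul] at h
  have hpos : ∀ e ∈ wStar r blk i v, 0 < lev n (wG r blk) 1 e := by
    intro e he
    rw [← hs] at he
    exact lev_pos hT (Finset.mem_inter.1 he).1
  have hcs := Finset.sq_sum_div_le_sum_sq_div (wStar r blk i v) (fun _ => (1 : ℝ)) hpos
  simp only [Finset.sum_const, wStar_card hv, nsmul_eq_mul, mul_one, one_pow] at hcs
  have hne : (wStar r blk i v).Nonempty := by
    rw [← Finset.card_pos, wStar_card hv]; exact h1
  have hS := Finset.sum_pos hpos hne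
  have hsp : (0 : ℝ) < (wB r blk i).card := Nat.cast_pos.2 h1
  generalize ((wB r blk i).card : ℝ) = s at *
  generalize ∑ e ∈ wStar r blk i v, lev n (wG r blk) 1 e = S at *
  have h2 : s * (s + 1) / 2 ≤ s ^ 2 / S := by
    rw [le_div_iff₀ hS]
    calc s * (s + 1) / 2 * S ≤ s * (s + 1) / 2 * (2 * s / (s + 1)) := by gcongr
      _ = s ^ 2 := by field_simp
  nlinarith

lemma main_abs (I : Finset (Fin n)) (s : ℕ) (hs : 0 < s) (hI : ∀ i ∈ I, (wB r blk i).card = s)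
    {c δ : ℝ} (hc : 2 * c < s + 1) (hδ : δ ≤ I.card / (((s : ℝ) + 1) ^ 2) ^ s) :
    1 - Real.exp (-δ) ≤
        ∑ T ∈ Finset.univ.filter (fun T : Finset (Sym2 (Fin n)) =>
          ¬ (c • lap n (wG r blk) 1 - treeLap n (wG r blk) 1 T).PosSemidef),
          treeProb n (wG r blk) 1 T := by
  choose ctr hctr hlev using fun i => exists_center (r := r) (blk := blk) i
  have hp : (0 : ℝ) < (wT r blk).card := Nat.cast_pos.2 wT_pos
  have hratio := wBad_ratio I ctr ((((s : ℝ) + 1) ^ 2) ^ s) (fun i _ => hctr i) (by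
    intro i hi
    have := wS_card_le (r := r) (blk := blk) i
    rw [hI i hi] at this
    exact_mod_cast this)
  have hsub : wT r blk \ wBad r blk I ctr ⊆ Finset.univ.filter (fun T : Finset (Sym2 (Fin n)) =>
          ¬ (c • lap n (wG r blk) 1 - treeLap n (wG r blk) 1 T).PosSemidef) := by
    intro T hT
    rw [Finset.mem_sdiff] at hT
    obtain ⟨h1, h2⟩ := hT
    have hT' : IsSpanningTree n (wG r blk) T := by
      simpa only [wT, Finset.mem_filter, Finset.mem_univ, true_and] using h1
    rw [wBad, Finset.mem_filter] at h2
    push Not at h2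
    obtain ⟨i, hi, hstar⟩ := h2 h1
    rw [Finset.mem_filter]
    refine ⟨Finset.mem_univ _, not_psd (hctr i) hT' hstar (hlev i) ?_ ?_⟩
    · rw [hI i hi]; exact hs
    · rw [hI i hi]; exact hc
  have hnn : ∀ T, 0 ≤ treeProb n (wG r blk) 1 T := by
    intro T; rw [treeProb_one]; split_ifs <;> positivity
  refine le_trans ?_ (Finset.sum_le_sum_of_subset_of_nonneg hsub fun T _ _ => hnn T)
  have hsum : ∑ T ∈ wT r blk \ wBad r blk I ctr, treeProb n (wG r blk) 1 T =
      ((wT r blk).card - (wBad r blk I ctr).card) * (1 / ((wT r blk).card : ℝ)) := by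
    rw [Finset.sum_congr rfl (g := fun _ => 1 / ((wT r blk).card : ℝ)), Finset.sum_const,
      nsmul_eq_mul, Finset.cast_card_sdiff (s := wBad r blk I ctr) (Finset.filter_subset _ _)]
    · intro T hT
      rw [treeProb_one, if_pos]
      simpa only [wT, Finset.mem_filter, Finset.mem_univ, true_and] using (Finset.mem_sdiff.1 hT).1
  rw [hsum, sub_mul, mul_one_div_cancel hp.ne']
  have h3 : Real.exp (-(I.card / (((s : ℝ) + 1) ^ 2) ^ s)) ≤ Real.exp (-δ) :=
    Real.exp_le_exp.2 (by linarith)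
  have h4 : ((wBad r blk I ctr).card : ℝ) * (1 / ((wT r blk).card : ℝ)) ≤ Real.exp (-δ) := by
    rw [mul_one_div, div_le_iff₀ hp]
    exact hratio.trans (mul_le_mul_of_nonneg_right h3 hp.le)
  linarith

lemma wG_conn : (wG r blk).Connected := by
  have : Nonempty (Fin n) := ⟨r⟩
  have h : ∀ v, (wG r blk).Reachable r v := by
    intro v
    by_cases hv : r = v
    · rw [hv]
    · exact SimpleGraph.Adj.reachable ⟨hv, Or.inl rfl⟩
  exact ⟨fun a b => (h a).symm.trans (h b)⟩

end windmill2

lemma blocks_card {n : ℕ} (hn : 0 < n) (s : ℕ) (hs : 0 < s) (i : Fin n) (hi : i.1 < (n - 1) / s) :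
    (wB (⟨0, hn⟩ : Fin n)
      (fun v => ⟨(v.1 - 1) / s, by have := Nat.div_le_self (v.1 - 1) s; have := v.2; omega⟩) i).card = s := by
  have hle : (i.1 + 1) * s ≤ n - 1 := by
    have := (Nat.le_div_iff_mul_le hs).1 (Nat.succ_le_of_lt hi)
    simpa using this
  have : ((wB (⟨0, hn⟩ : Fin n)
      (fun v => ⟨(v.1 - 1) / s, by have := Nat.div_le_self (v.1 - 1) s; have := v.2; omega⟩) i).map
        Fin.valEmbedding) = Finset.Ico (i.1 * s + 1) (i.1 * s + 1 + s) := by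
    ext k
    simp only [Finset.mem_map, wB_mem, Fin.valEmbedding_apply, Finset.mem_Ico, Fin.ext_iff, ne_eq]
    rw [Nat.add_mul, one_mul] at hle
    constructor
    · rintro ⟨v, ⟨h1, h2⟩, rfl⟩
      rw [Nat.div_eq_iff hs] at h2
      omega
    · rintro ⟨h1, h2⟩
      refine ⟨⟨k, by omega⟩, ⟨by simp; omega, ?_⟩, rfl⟩
      simp only
      rw [Nat.div_eq_iff hs]
      omega
  rw [← Finset.card_map Fin.valEmbedding, this, Nat.card_Ico]
  omega

lemma two_rpow_ge {x : ℝ} (hx : 0 ≤ x) : x ≤ (2 : ℝ) ^ x := by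
  have h2 : (2 : ℝ) ^ x = 2 ^ (x / 2) * 2 ^ (x / 2) := by
    rw [← Real.rpow_add (by norm_num)]; congr 1; ring
  have h1 : 0.345 * x + 1 ≤ (2 : ℝ) ^ (x / 2) := by
    have := Real.add_one_le_exp (x / 2 * Real.log 2)
    have hlog : (0.69 : ℝ) < Real.log 2 := by have := Real.log_two_gt_d9; linarith
    rw [Real.rpow_def_of_pos (by norm_num), mul_comm (Real.log 2)]
    nlinarith
  rw [h2]
  have h3 := mul_self_le_mul_self (by positivity : (0 : ℝ) ≤ 0.345 * x + 1) h1
  refine le_trans ?_ h3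
  nlinarith [sq_nonneg (x - 1.3)]

lemma arith {n : ℕ} (hn : 2 ^ 64 ≤ n) {s : ℕ}
    (hs : s = ⌊2 * (Real.logb 2 n / (8 * Real.logb 2 (Real.logb 2 n)))⌋₊) :
    0 < s ∧ 2 * (Real.logb 2 n / (8 * Real.logb 2 (Real.logb 2 n))) < s + 1 ∧
    (n : ℝ) ^ (0.4 : ℝ) ≤ (((n - 1) / s : ℕ) : ℝ) / (((s : ℝ) + 1) ^ 2) ^ s := by
  have hn' : (2 : ℝ) ^ (64 : ℝ) ≤ n := by
    have : ((2 ^ 64 : ℕ) : ℝ) ≤ n := Nat.cast_le.2 hn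
    refine le_trans (le_of_eq ?_) this
    norm_num
  have hnpos : (0 : ℝ) < n := lt_of_lt_of_le (by positivity) hn'
  set L := Real.logb 2 n with hL
  have hL64 : 64 ≤ L := by
    rw [hL, Real.le_logb_iff_rpow_le (by norm_num) hnpos]; exact hn'
  set l := Real.logb 2 L with hl
  have hLpos : 0 < L := by linarith
  have hl6 : 6 ≤ l := by
    rw [hl, Real.le_logb_iff_rpow_le (by norm_num) hLpos]
    refine le_trans (le_of_eq ?_) hL64
    norm_num
  have hnL : (n : ℝ) = 2 ^ L := (Real.rpow_logb (by norm_num) (by norm_num) hnpos).symm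
  have hLl : L = 2 ^ l := (Real.rpow_logb (by norm_num) (by norm_num) hLpos).symm
  have hsub : 2 * (L / (8 * l)) = L / (4 * l) := by field_simp; ring
  rw [hsub] at hs ⊢
  -- l ≤ L / 8 is enough for positivity
  have hlL : 4 * l ≤ L := by
    have h1 : l ≤ 2 * 2 ^ (l / 2) := by
      have := two_rpow_ge (x := l / 2) (by linarith)
      linarith
    have h2 : L = 2 ^ (l / 2) * 2 ^ (l / 2) := by
      rw [← Real.rpow_add (by norm_num)]; refine hLl.trans ?_; congr 1; ring
    have h3 : (8 : ℝ) ≤ 2 ^ (l / 2) := by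
      calc (8 : ℝ) = 2 ^ (3 : ℝ) := by norm_num
        _ ≤ _ := Real.rpow_le_rpow_of_exponent_le (by norm_num) (by linarith)
    nlinarith
  have hspos : 0 < s := by
    rw [hs, Nat.floor_pos, le_div_iff₀ (by linarith)]; linarith
  have hsle : (s : ℝ) ≤ L / (4 * l) := by rw [hs]; exact Nat.floor_le (by positivity)
  have hslt : L / (4 * l) < s + 1 := by rw [hs]; exact Nat.lt_floor_add_one _
  refine ⟨hspos, hslt, ?_⟩
  have hs24 : (s : ℝ) * 24 ≤ L := by
    have : L / (4 * l) ≤ L / 24 := by gcongr; linarith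
    linarith
  have hsl : 4 * (s * l) ≤ L := by
    rw [le_div_iff₀ (by positivity)] at hsle; linarith
  have hM : (((s : ℝ) + 1) ^ 2) ^ s ≤ (2 : ℝ) ^ (L / 2) := by
    have h1 : (s : ℝ) + 1 ≤ L := by linarith
    calc (((s : ℝ) + 1) ^ 2) ^ s ≤ (L ^ 2) ^ s := by gcongr
      _ = (2 : ℝ) ^ (l * (2 * s)) := by
        rw [Real.rpow_mul (by norm_num), ← hLl, ← pow_mul]
        rw [← Real.rpow_natCast]; push_cast; rfl
      _ ≤ _ := Real.rpow_le_rpow_of_exponent_le (by norm_num) (by linarith)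
  have hs1 : (1 : ℝ) ≤ s := by exact_mod_cast hspos
  have hnbig : 4 * L + 4 ≤ (n : ℝ) := by
    have h1 : L ≤ 2 * 2 ^ (L / 2) := by
      have := two_rpow_ge (x := L / 2) (by linarith)
      linarith
    have h2 : (n : ℝ) = 2 ^ (L / 2) * 2 ^ (L / 2) := by
      rw [← Real.rpow_add (by norm_num)]; refine hnL.trans ?_; congr 1; ring
    have h3 : (16 : ℝ) ≤ 2 ^ (L / 2) := by
      calc (16 : ℝ) = 2 ^ (4 : ℝ) := by norm_num
        _ ≤ _ := Real.rpow_le_rpow_of_exponent_le (by norm_num) (by linarith)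
    nlinarith
  have hm : (n : ℝ) / (2 * s) ≤ (((n - 1) / s : ℕ) : ℝ) := by
    have h1 : n - 1 < s * ((n - 1) / s) + s := by
      have := Nat.lt_mul_div_succ (n - 1) hspos
      rw [Nat.mul_add, mul_one] at this
      exact this
    have h2 : n ≤ s * ((n - 1) / s) + s := by omega
    have h3 : (n : ℝ) ≤ s * (((n - 1) / s : ℕ) : ℝ) + s := by exact_mod_cast h2
    rw [div_le_iff₀ (by positivity)]
    nlinarith
  have h2s : 2 * (s : ℝ) ≤ 2 ^ (L / 10) := by
    have := two_rpow_ge (x := L / 10) (by linarith)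
    linarith
  rw [le_div_iff₀ (by positivity)]
  refine le_trans ?_ hm
  rw [le_div_iff₀ (by positivity)]
  calc (n : ℝ) ^ (0.4 : ℝ) * (((s : ℝ) + 1) ^ 2) ^ s * (2 * s)
      ≤ (n : ℝ) ^ (0.4 : ℝ) * 2 ^ (L / 2) * 2 ^ (L / 10) := by gcongr
    _ = n := by
      have h1 : (n : ℝ) ^ (0.4 : ℝ) = 2 ^ (L * 0.4) := by
        rw [Real.rpow_mul (by norm_num), ← hnL]
      rw [h1, ← Real.rpow_add (by norm_num), ← Real.rpow_add (by norm_num)]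
      refine Eq.trans ?_ hnL.symm
      congr 1; ring

/-- lower bound for a single random spanning tree, high probability. -/
theorem one_spanning_tree_lower_high_probability :
    ∀ n : ℕ, 2 ^ 64 ≤ n →
    ∃ G : SimpleGraph (Fin n), G.Connected ∧
      1 - Real.exp (-(n : ℝ) ^ (0.4 : ℝ)) ≤
        ∑ T ∈ Finset.univ.filter (fun T : Finset (Sym2 (Fin n)) =>
          ¬ ((Real.logb 2 n / (8 * Real.logb 2 (Real.logb 2 n))) • lap n G 1
              - treeLap n G 1 T).PosSemidef),
          treeProb n G 1 T := by
  intro n hn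
  obtain ⟨hs, hc, hδ⟩ := arith hn rfl
  generalize ⌊2 * (Real.logb 2 n / (8 * Real.logb 2 (Real.logb 2 n)))⌋₊ = s at hs hc hδ
  have hn0 : 0 < n := lt_of_lt_of_le (by norm_num) hn
  refine ⟨wG (⟨0, hn0⟩ : Fin n) (fun v => ⟨(v.1 - 1) / s, by
    have := Nat.div_le_self (v.1 - 1) s; have := v.2; omega⟩), wG_conn, ?_⟩
  refine main_abs (Finset.univ.filter (fun i : Fin n => i.1 < (n - 1) / s)) s hs ?_ hc ?_
  · intro i hi
    exact blocks_card hn0 s hs i (Finset.mem_filter.1 hi).2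
  · refine hδ.trans (le_of_eq ?_)
    congr 2
    rw [Fin.card_filter_val_lt, min_eq_right]
    exact (Nat.div_le_self _ _).trans (by omega)

end
end

section
/- For every n ≥ 2^{100} there exists a connected unweighted graph G on n vertices with the following property: for every ε ∈ (5·n^{−0.1}, 1/2), letting t = ⌊0.05·ε^{−2}·log n⌋ and sampling t independent uniform random spanning trees T_1, …, T_t of G, each with inverse-leverage-score-weighted Laplacian L_{T_i}, with probability at least 1 − e^{−n^{0.39}} both (1−ε)·L_G ⋠ (1/t)·Σ_{i=1}^t L_{T_i} and (1/t)·Σ_{i=1}^t L_{T_i} ⋠ (1+ε)·L_G. -/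
open Matrix Finset
attribute [local instance] Classical.propDecidable

noncomputable section

lemma aux_log1 (s : ℝ) (h0 : 0 ≤ s) (h1 : s < 1) : Real.log (1 - s) ≤ -(s + s^2/2) := by
  have h := Real.hasSum_pow_div_log_of_abs_lt_one (x := s) (by rw [abs_of_nonneg h0]; exact h1)
  have := h.summable.sum_le_tsum (Finset.range 2) (fun i _ => by positivity)
  rw [h.tsum_eq] at this
  norm_num [Finset.sum_range_succ] at this
  linarith

lemma aux_log2 (x : ℝ) (h0 : 0 ≤ x) : Real.log (1 + x) ≤ (x^2+6*x)/(2*(2*x+3)) := by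
  let f : ℝ → ℝ := fun x => (x^2+6*x)/(2*(2*x+3)) - Real.log (1+x)
  have hd : ∀ y : ℝ, 0 ≤ y → HasDerivAt f (((2*y+6)*(2*(2*y+3)) - (y^2+6*y)*4)/(2*(2*y+3))^2 - 1/(1+y)) y := by
    intro y hy
    apply HasDerivAt.sub
    · apply HasDerivAt.div
      · have h1 := (hasDerivAt_pow 2 y).add ((hasDerivAt_id y).const_mul 6)
        refine (h1.congr_deriv ?_).congr_of_eventuallyEq ?_
        · simp
        · exact Filter.Eventually.of_forall (fun z => by simp)
      · have h1 := (((hasDerivAt_id y).const_mul 2).add_const 3).const_mul 2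
        refine (h1.congr_deriv ?_)
        norm_num
      · positivity
    · have h1 := ((hasDerivAt_id y).const_add 1).log (by simp; linarith)
      simpa using h1
  have hm : MonotoneOn f (Set.Ici 0) := by
    apply monotoneOn_of_deriv_nonneg (convex_Ici 0)
    · intro y hy; exact (hd y hy).continuousAt.continuousWithinAt
    · intro y hy; rw [interior_Ici] at hy; exact (hd y (le_of_lt hy)).differentiableAt.differentiableWithinAt
    · intro y hy; rw [interior_Ici] at hy
      have hy' : 0 < y := hy
      rw [(hd y hy'.le).deriv, sub_nonneg, div_le_div_iff₀ (by positivity) (by positivity)]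
      nlinarith [pow_pos hy' 3, pow_pos hy' 2]
  have := hm (Set.mem_Ici.2 le_rfl) (Set.mem_Ici.2 h0) h0
  simp only [f] at this
  norm_num at this
  linarith

lemma aux_kl (s : ℝ) (h0 : 0 ≤ s) (h1 : s ≤ 1) :
    (1+2*s)*Real.log (1+2*s) + 2*(1-s)*Real.log (1-s) ≤ 7/2*s^2 := by
  have a := aux_log2 (2*s) (by linarith)
  have b : (1-s)*Real.log (1-s) ≤ (1-s) * (-(s+s^2/2)) := by
    rcases eq_or_lt_of_le h1 with h | h
    · simp [h]
    · exact mul_le_mul_of_nonneg_left (aux_log1 s h0 h) (by linarith)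
  have c : (1+2*s)*Real.log (1+2*s) ≤ (1+2*s)*(((2*s)^2+6*(2*s))/(2*(2*(2*s)+3))) :=
    mul_le_mul_of_nonneg_left a (by linarith)
  have d : (1+2*s)*(((2*s)^2+6*(2*s))/(2*(2*(2*s)+3))) ≤ 2*s + 5/2*s^2 - s^3 := by
    rw [← mul_div_assoc, div_le_iff₀ (by positivity)]
    nlinarith [mul_nonneg (pow_nonneg h0 2) (sub_nonneg.2 h1), mul_nonneg (pow_nonneg h0 3) (sub_nonneg.2 h1), pow_nonneg h0 2, pow_nonneg h0 3]
  nlinarith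

/-- the binomial term -/
lemma aux_type (t M : ℕ) (hM : M ≤ t) (ht : 0 < t) :
    (t:ℝ)^t ≤ (t+1) * (t.choose M * (M:ℝ)^M * ((t:ℝ)-M)^(t-M)) := by
  set b : ℕ → ℝ := fun j => t.choose j * (M:ℝ)^j * ((t:ℝ)-M)^(t-j) with hb
  have hMt : (0:ℝ) ≤ (t:ℝ)-M := by have : (M:ℝ) ≤ t := by exact_mod_cast hM
                                   linarith
  have hrec : ∀ j, j < t → b (j+1) * ((j+1) * ((t:ℝ)-M)) = b j * ((t-j) * M) := by
    intro j hj
    have h1 : ((t.choose (j+1) : ℕ):ℝ) * (j+1) = t.choose j * (t - j) := by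
      have := Nat.choose_succ_right_eq t j
      have h2 : ((t - j : ℕ):ℝ) = t - j := by push_cast [hj.le]; ring
      rw [← h2]; exact_mod_cast this
    have h3 : t - j = (t - (j+1)) + 1 := by omega
    simp only [hb]
    rw [h3, pow_succ, pow_succ]
    linear_combination ((M:ℝ)^j * M * ((t:ℝ)-M)^(t-(j+1)) * ((t:ℝ)-M)) * h1
  have hb0 : ∀ j, 0 ≤ b j := fun j => by simp only [hb]; positivity
  have hmax : ∀ j, j ≤ t → b j ≤ b M := by
    rcases Nat.eq_zero_or_pos M with h0 | hpos
    · subst h0; intro j hj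
      rcases Nat.eq_zero_or_pos j with h | h
      · rw [h]
      · simp only [hb]; rw [Nat.cast_zero, zero_pow h.ne']; simp
    rcases eq_or_lt_of_le hM with hE | hlt
    · intro j hj
      rcases eq_or_lt_of_le hj with h | h
      · rw [h, hE]
      · have : b j = 0 := by
          simp only [hb]; rw [hE, sub_self, zero_pow (by omega)]; simp
        rw [this]; exact hb0 _
    have hMr : (0:ℝ) < M := by exact_mod_cast hpos
    have hMt' : (0:ℝ) < (t:ℝ)-M := by
      have : (M:ℝ) < t := by exact_mod_cast hlt
      linarith
    have up : ∀ j, j < M → b j ≤ b (j+1) := by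
      intro j hj
      have e := hrec j (by omega)
      have hjr : (j:ℝ)+1 ≤ M := by exact_mod_cast hj
      have hp : (0:ℝ) < (j+1) * ((t:ℝ)-M) := by positivity
      have hle : (j+1) * ((t:ℝ)-M) ≤ (t-j) * M := by nlinarith
      have := mul_le_mul_of_nonneg_left hle (hb0 j)
      rw [← e] at this
      exact le_of_mul_le_mul_right this hp
    have down : ∀ j, M ≤ j → j < t → b (j+1) ≤ b j := by
      intro j hj hjt
      have e := hrec j (by omega)
      have hjr : (M:ℝ) ≤ j := by exact_mod_cast hj
      have hp : (0:ℝ) < (j+1) * ((t:ℝ)-M) := by positivity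
      have hle : (t-j) * M ≤ (j+1) * ((t:ℝ)-M) := by nlinarith
      have := mul_le_mul_of_nonneg_left hle (hb0 j)
      rw [← e] at this
      exact le_of_mul_le_mul_right this hp
    have up' : ∀ d, d ≤ M → b (M-d) ≤ b M := by
      intro d; induction d with
      | zero => intro _; simp
      | succ d ih => 
        intro hd
        have := up (M-(d+1)) (by omega)
        rw [show M-(d+1)+1 = M-d by omega] at this
        exact this.trans (ih (by omega))
    have down' : ∀ d, M + d ≤ t → b (M+d) ≤ b M := by
      intro d; induction d with
      | zero => intro _; simp
      | succ d ih => 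
        intro hd
        exact (down (M+d) (by omega) (by omega)).trans (ih (by omega))
    intro j hj
    rcases le_total j M with h | h
    · have := up' (M-j) (by omega)
      rwa [show M-(M-j) = j by omega] at this
    · have := down' (j-M) (by omega)
      rwa [show M+(j-M) = j by omega] at this
  have hsum : (t:ℝ)^t = ∑ j ∈ Finset.range (t+1), b j := by
    have := add_pow (M:ℝ) ((t:ℝ)-M) t
    rw [show (M:ℝ) + ((t:ℝ)-M) = t by ring] at this
    rw [this]
    exact Finset.sum_congr rfl (fun j _ => by simp only [hb]; ring)
  rw [hsum]
  calc _ ≤ ∑ j ∈ Finset.range (t+1), b M := Finset.sum_le_sum (fun j hj => hmax j (by simp at hj; omega))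
    _ = _ := by simp [hb]

lemma aux_tail (t M : ℕ) (hM : M ≤ t) (ht : 0 < t) (s : ℝ) (hs : (M:ℝ) = t * (1 + 2*s)/3) (h0 : 0 ≤ s) :
    Real.exp (-(7/6 * t * s^2)) ≤ (t+1) * (t.choose M * 2^(t-M) / 3^t) := by
  have htr : (0:ℝ) < t := by exact_mod_cast ht
  have hMr : (M:ℝ) ≤ t := by exact_mod_cast hM
  have h1 : s ≤ 1 := by
    by_contra h
    push Not at h
    have : (t:ℝ) * 1 < t * s := by apply mul_lt_mul_of_pos_left h htr
    nlinarith
  have hT := aux_type t M hM ht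
  have e1 : (M:ℝ)^M = (t/3:ℝ)^M * (1+2*s)^M := by
    rw [← mul_pow]; congr 1; rw [hs]; ring
  have e2 : ((t:ℝ)-M)^(t-M) = (t/3:ℝ)^(t-M) * 2^(t-M) * (1-s)^(t-M) := by
    rw [← mul_pow, ← mul_pow]; congr 1; rw [hs]; ring
  have e3 : (t/3:ℝ)^M * (t/3:ℝ)^(t-M) = (t:ℝ)^t / 3^t := by
    rw [← pow_add, Nat.add_sub_cancel' hM, div_pow]
  have hX : (1+2*s)^M * (1-s)^(t-M) ≤ Real.exp (7/6 * t * s^2) := by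
    have a1 : (1+2*s)^M = Real.exp (M * Real.log (1+2*s)) := by
      rw [mul_comm (M:ℝ), Real.exp_mul, Real.exp_log (by linarith), Real.rpow_natCast]
    have a2 : (1-s)^(t-M) = Real.exp (((t:ℝ)-M) * Real.log (1-s)) := by
      rcases eq_or_lt_of_le h1 with h | h
      · have : M = t := by
          have : (M:ℝ) = t := by rw [hs, h]; ring
          exact_mod_cast this
        simp [this]
      · rw [show (t:ℝ)-M = ((t-M:ℕ):ℝ) by push_cast [hM]; ring, mul_comm, Real.exp_mul, Real.exp_log (by linarith), Real.rpow_natCast]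
    rw [a1, a2, ← Real.exp_add, Real.exp_le_exp, hs]
    have := mul_le_mul_of_nonneg_left (aux_kl s h0 h1) (show (0:ℝ) ≤ t/3 by positivity)
    nlinarith
  rw [Real.exp_neg]
  have hE := Real.exp_pos (7/6 * t * s^2)
  rw [inv_le_iff_one_le_mul₀ hE]
  have htt : (0:ℝ) < (t:ℝ)^t := by positivity
  have hT2 : (t:ℝ)^t * 1 ≤ (t:ℝ)^t * ((t+1) * (t.choose M * 2^(t-M) / 3^t) * ((1+2*s)^M * (1-s)^(t-M))) := by
    calc (t:ℝ)^t * 1 = (t:ℝ)^t := mul_one _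
      _ ≤ _ := hT
      _ = (t+1) * (t.choose M * ((t/3:ℝ)^M * (t/3:ℝ)^(t-M)) * 2^(t-M)) * ((1+2*s)^M * (1-s)^(t-M)) := by rw [e1, e2]; ring
      _ = _ := by rw [e3]; ring
  have hT3 := le_of_mul_le_mul_left hT2 htt
  refine hT3.trans (mul_le_mul_of_nonneg_left hX (by positivity))

set_option maxHeartbeats 2000000 in
lemma aux_final (n k t : ℕ) (ε : ℝ) (hn : 2^100 ≤ n) (hk : n ≤ 2*k+2)
    (h1 : 5 * (n : ℝ) ^ (-(0.1 : ℝ)) < ε) (h2 : ε < 1/2)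
    (ht : t = ⌊0.05 * ε⁻¹ ^ 2 * Real.logb 2 n⌋₊) :
    0 < t ∧ ∃ M : ℕ, M ≤ t ∧ (t:ℝ) * (1/3 + 4*ε/3) < M ∧
      (n:ℝ)^(0.39:ℝ) ≤ k * (t.choose M * 2^(t-M) / 3^t) := by
  have hnr : (2:ℝ)^100 ≤ n := by exact_mod_cast hn
  have hn0 : (0:ℝ) < n := lt_of_lt_of_le (by positivity) hnr
  have hl2 : 0 < Real.log 2 := Real.log_pos (by norm_num)
  set L := Real.logb 2 n with hL
  have hnL : (n:ℝ) = Real.exp (L * Real.log 2) := by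
    rw [hL, Real.logb, div_mul_cancel₀ _ hl2.ne', Real.exp_log hn0]
  have hnp : ∀ a : ℝ, (n:ℝ)^a = Real.exp (a * L * Real.log 2) := by
    intro a
    rw [hnL, ← Real.exp_mul]; congr 1; ring
  have hL100 : 100 ≤ L := by
    rw [hL, Real.le_logb_iff_rpow_le (by norm_num) hn0]
    exact_mod_cast hnr
  have hε : 0 < ε := lt_trans (by positivity) h1
  have hinv : 2 ≤ ε⁻¹ := by
    rw [le_inv_comm₀ (by norm_num) hε]; linarith
  have hx0 : (0:ℝ) ≤ 0.05 * ε⁻¹^2 * L := by positivity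
  have ht20 : 20 ≤ t := by
    rw [ht]; apply Nat.le_floor
    have : (4:ℝ) ≤ ε⁻¹^2 := by nlinarith
    push_cast
    nlinarith
  have htle : (t:ℝ) ≤ 0.05 * ε⁻¹^2 * L := by rw [ht]; exact Nat.floor_le hx0
  have htr : (20:ℝ) ≤ t := by exact_mod_cast ht20
  have htε : (t:ℝ) * ε^2 ≤ 0.05 * L := by
    calc (t:ℝ) * ε^2 ≤ 0.05 * ε⁻¹^2 * L * ε^2 := by gcongr
      _ = 0.05 * L := by field_simp
  have hinv2 : ε⁻¹ ≤ (n:ℝ)^(0.1:ℝ) / 5 := by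
    rw [inv_le_comm₀ hε (by positivity)]
    have : ((n:ℝ)^(0.1:ℝ)/5)⁻¹ = 5 * (n : ℝ) ^ (-(0.1 : ℝ)) := by
      rw [Real.rpow_neg hn0.le]; field_simp
    rw [this]; exact h1.le
  have hinv3 : ε⁻¹^2 ≤ (n:ℝ)^(0.2:ℝ)/25 := by
    calc ε⁻¹^2 ≤ ((n:ℝ)^(0.1:ℝ) / 5)^2 := by gcongr
      _ = _ := by
        rw [div_pow, ← Real.rpow_natCast, ← Real.rpow_mul hn0.le]; norm_num
  have htn : (t:ℝ) ≤ 0.002 * (n:ℝ)^(0.2:ℝ) * L := by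
    calc (t:ℝ) ≤ 0.05 * ε⁻¹^2 * L := htle
      _ ≤ 0.05 * ((n:ℝ)^(0.2:ℝ)/25) * L := by gcongr
      _ = _ := by ring
  have hn02 : (2:ℝ)^20 ≤ (n:ℝ)^(0.2:ℝ) := by
    calc (2:ℝ)^20 = ((2:ℝ)^(100:ℕ))^(0.2:ℝ) := by
          rw [← Real.rpow_natCast, ← Real.rpow_natCast, ← Real.rpow_mul (by norm_num)]; norm_num
      _ ≤ _ := by gcongr
  have ht1 : (t:ℝ)+1 ≤ 0.0021 * (n:ℝ)^(0.2:ℝ) * L := by nlinarith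
  have hLe : L ≤ 100 * Real.exp (L/100-1) := by
    have := Real.add_one_le_exp (L/100-1)
    linarith
  have ht2 : (t:ℝ)+1 ≤ 0.21 * Real.exp (0.2*L*Real.log 2 + (L/100-1)) := by
    rw [Real.exp_add, ← hnp]
    calc (t:ℝ)+1 ≤ _ := ht1
      _ ≤ 0.0021 * (n:ℝ)^(0.2:ℝ) * (100 * Real.exp (L/100-1)) := by gcongr
      _ = _ := by ring
  refine ⟨by omega, ⌊(t:ℝ) * (1/3 + 4*ε/3)⌋₊+1, ?_, by push_cast; exact Nat.lt_floor_add_one _, ?_⟩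
  · rw [Nat.add_one_le_iff, Nat.floor_lt (by positivity)]
    nlinarith
  have hMt : ⌊(t:ℝ) * (1/3 + 4*ε/3)⌋₊+1 ≤ t := by
    rw [Nat.add_one_le_iff, Nat.floor_lt (by positivity)]
    nlinarith
  have hM1 : (t:ℝ) * (1/3 + 4*ε/3) < ((⌊(t:ℝ) * (1/3 + 4*ε/3)⌋₊+1 : ℕ) : ℝ) := by
    push_cast; exact Nat.lt_floor_add_one _
  have hM2 : ((⌊(t:ℝ) * (1/3 + 4*ε/3)⌋₊+1 : ℕ) : ℝ) ≤ (t:ℝ) * (1/3 + 4*ε/3) + 1 := by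
    push_cast; have := Nat.floor_le (show 0 ≤ (t:ℝ) * (1/3 + 4*ε/3) by positivity); linarith
  generalize ⌊(t:ℝ) * (1/3 + 4*ε/3)⌋₊+1 = M at *
  have ht0 : (0:ℝ) < t := by linarith
  have hs1 : (M:ℝ) = t * (1 + 2*((3*M/t-1)/2))/3 := by field_simp; ring
  have hs0 : 0 ≤ ((3*M/t-1)/2 : ℝ) := by
    have : 1 ≤ (3*M/t:ℝ) := by rw [le_div_iff₀ ht0]; nlinarith
    linarith
  have hs2 : ((3*M/t-1)/2 : ℝ) ≤ 2*ε + 3/2/t := by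
    have : (3*M/t:ℝ) ≤ 1 + 4*ε + 3/t := by
      rw [div_le_iff₀ ht0]; field_simp; nlinarith
    have e : (3/2/t:ℝ) = 3/t/2 := by ring
    rw [e]; linarith
  have hT := aux_tail t M hMt (by omega) _ hs1 hs0
  set s := ((3*M/t-1)/2 : ℝ)
  set q := (t.choose M * 2^(t-M) / 3^t : ℝ)
  have hq : 0 ≤ q := by positivity
  have hts : (t:ℝ) * s^2 ≤ 0.2*L + 3.1125 := by
    calc (t:ℝ) * s^2 ≤ t * (2*ε + 3/2/t)^2 := by gcongr
      _ = 4 * (t * ε^2) + 6*ε + 9/4/t := by field_simp; ring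
      _ ≤ 4 * (0.05*L) + 3 + 9/4/20 := by gcongr; linarith
      _ = _ := by ring
  have hkn : 0.49 * (n:ℝ) ≤ k := by
    have : (n:ℝ) ≤ 2*k+2 := by exact_mod_cast hk
    have h1000 : (1000:ℝ) ≤ n := le_trans (by norm_num) hnr
    linarith
  have hq2 : Real.exp (-(0.7/3*L + 3.6313)) ≤ (0.21 * Real.exp (0.2*L*Real.log 2 + (L/100-1))) * q := by
    calc _ ≤ Real.exp (-(7/6 * t * s^2)) := by
            rw [Real.exp_le_exp]; linarith
      _ ≤ _ := hT
      _ ≤ _ := by gcongr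
  have hq3 : Real.exp (-(0.7/3*L + 3.6313) - (0.2*L*Real.log 2 + (L/100-1))) ≤ 0.21 * q := by
    rw [Real.exp_sub, div_le_iff₀ (Real.exp_pos _)]
    linarith
  have hfin : (n:ℝ)^(0.39:ℝ) ≤ n * Real.exp (-(0.7/3*L + 3.6313) - (0.2*L*Real.log 2 + (L/100-1))) := by
    rw [hnp, hnL, ← Real.exp_add, Real.exp_le_exp]
    have h69 : 0.6931 * L ≤ L * Real.log 2 := by
      rw [mul_comm]
      exact mul_le_mul_of_nonneg_left (by have := Real.log_two_gt_d9; linarith) (by linarith)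
    linarith
  calc (n:ℝ)^(0.39:ℝ) ≤ _ := hfin
    _ ≤ n * (0.21 * q) := by gcongr
    _ ≤ 0.49 * n * q := by nlinarith [mul_nonneg hn0.le hq]
    _ ≤ k * q := by gcongr

def vz {n k : ℕ} (h : 2*k+1 ≤ n) : Fin n := ⟨0, by omega⟩
def va {n k : ℕ} (h : 2*k+1 ≤ n) (j : Fin k) : Fin n := ⟨2*j.1+1, by have := j.2; omega⟩
def vb {n k : ℕ} (h : 2*k+1 ≤ n) (j : Fin k) : Fin n := ⟨2*j.1+2, by have := j.2; omega⟩
def ed {n k : ℕ} (h : 2*k+1 ≤ n) (p : Fin k × Fin 3) : Sym2 (Fin n) :=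
  ![s(va h p.1, vb h p.1), s(vz h, va h p.1), s(vz h, vb h p.1)] p.2
def pend {n k : ℕ} (h : 2*k+1 ≤ n) : Finset (Sym2 (Fin n)) :=
  (univ.filter (fun v : Fin n => 2*k < v.1)).image (fun v => s(vz h, v))
def Phi {n k : ℕ} (h : 2*k+1 ≤ n) (r : Fin k → Fin 3) : Finset (Sym2 (Fin n)) :=
  pend h ∪ (univ.filter (fun p : Fin k × Fin 3 => p.2 ≠ r p.1)).image (ed h)
def EE {n k : ℕ} (h : 2*k+1 ≤ n) : Finset (Sym2 (Fin n)) :=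
  pend h ∪ univ.image (ed h)
def GG {n k : ℕ} (h : 2*k+1 ≤ n) : SimpleGraph (Fin n) := SimpleGraph.fromEdgeSet (EE h)

lemma ed_inj {n k : ℕ} (h : 2*k+1 ≤ n) : Function.Injective (ed h) := by
  rintro ⟨i, c⟩ ⟨j, d⟩ he
  fin_cases c <;> fin_cases d <;> simp [ed, va, vb, vz, Fin.ext_iff] at he ⊢ <;> omega

lemma ed_not_pend {n k : ℕ} (h : 2*k+1 ≤ n) (p) : ed h p ∉ pend h := by
  obtain ⟨j, c⟩ := p
  have := j.2
  simp only [pend, mem_image, mem_filter, mem_univ, true_and, not_exists, not_and]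
  intro v hv he
  fin_cases c <;> simp [ed, va, vb, vz, Fin.ext_iff] at he <;> omega

lemma disj_pend {n k : ℕ} (h : 2*k+1 ≤ n) (S : Finset (Fin k × Fin 3)) :
    Disjoint (pend h) (S.image (ed h)) := by
  rw [Finset.disjoint_right]
  intro e he
  obtain ⟨p, _, rfl⟩ := mem_image.1 he
  exact ed_not_pend h p

lemma pend_card {n k : ℕ} (h : 2*k+1 ≤ n) : (pend h).card = n - 1 - 2*k := by
  rw [pend, card_image_of_injective]
  · have : (univ.filter (fun v : Fin n => 2*k < v.1)) = Finset.Ioi (⟨2*k, by omega⟩ : Fin n) := by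
      ext v; simp [Fin.lt_def]
    rw [this, Fin.card_Ioi]
  · intro u v huv
    rcases Sym2.eq_iff.1 huv with ⟨_, h2⟩ | ⟨h1, h2⟩
    · exact h2
    · exact h2.trans h1

lemma EE_edgeSet {n k : ℕ} (h : 2*k+1 ≤ n) : (GG h).edgeSet = (EE h : Set (Sym2 (Fin n))) := by
  rw [GG, SimpleGraph.edgeSet_fromEdgeSet]
  rw [sdiff_eq_left, Set.disjoint_left]
  intro e he hd
  simp only [EE, coe_union, coe_image, Set.mem_union, mem_coe, pend, Set.mem_image] at he
  rcases he with ⟨v, hv, rfl⟩ | ⟨⟨j, c⟩, _, rfl⟩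
  · have : vz h = v := by simpa using hd
    simp [← this, vz] at hv
  · fin_cases c <;> simp [ed, va, vb, vz, Fin.ext_iff] at hd

lemma Phi_card {n k : ℕ} (h : 2*k+1 ≤ n) (r : Fin k → Fin 3) : (Phi h r).card = n - 1 := by
  rw [Phi, card_union_of_disjoint (disj_pend h _), pend_card, card_image_of_injective _ (ed_inj h)]
  have : (univ.filter (fun p : Fin k × Fin 3 => p.2 ≠ r p.1)).card = 2*k := by
    have hc := Finset.card_eq_sum_card_fiberwise (f := Prod.fst)
      (s := univ.filter (fun p : Fin k × Fin 3 => p.2 ≠ r p.1)) (t := univ) (fun _ _ => by simp)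
    rw [hc]
    have : ∀ j : Fin k, (filter (fun a : Fin k × Fin 3 => a.1 = j) (univ.filter (fun p : Fin k × Fin 3 => p.2 ≠ r p.1))).card = 2 := by
      intro j
      have : filter (fun a : Fin k × Fin 3 => a.1 = j) (univ.filter (fun p : Fin k × Fin 3 => p.2 ≠ r p.1))
        = (univ.erase (r j)).image (fun c => (j, c)) := by
        ext ⟨a, b⟩
        simp only [mem_filter, mem_univ, true_and, mem_image, mem_erase, Prod.mk.injEq]
        constructor
        · rintro ⟨h1, rfl⟩; exact ⟨b, ⟨h1, trivial⟩, rfl, rfl⟩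
        · rintro ⟨c, ⟨h1, _⟩, rfl, rfl⟩; exact ⟨h1, rfl⟩
      rw [this, card_image_of_injective _ (fun a b hab => by simpa using hab), card_erase_of_mem (mem_univ _)]
      simp
    rw [Finset.sum_congr rfl (fun j _ => this j)]
    simp [mul_comm]
  omega

lemma Phi_sub {n k : ℕ} (h : 2*k+1 ≤ n) (r : Fin k → Fin 3) : Phi h r ⊆ EE h := by
  apply Finset.union_subset_union le_rfl
  exact Finset.image_subset_image (Finset.filter_subset _ _)

lemma mem_Phi {n k : ℕ} (h : 2*k+1 ≤ n) (r : Fin k → Fin 3) (p) : ed h p ∈ Phi h r ↔ p.2 ≠ r p.1 := by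
  rw [Phi, mem_union, mem_image]
  constructor
  · rintro (h1 | ⟨q, hq, he⟩)
    · exact absurd h1 (ed_not_pend h p)
    · rw [← ed_inj h he]; simpa using hq
  · intro hp; exact Or.inr ⟨p, by simpa using hp, rfl⟩

lemma Phi_inj {n k : ℕ} (h : 2*k+1 ≤ n) : Function.Injective (Phi h) := by
  intro r r' he
  funext j
  by_contra hne
  have h1 := (mem_Phi h r (j, r' j)).2 (fun h => hne h.symm)
  rw [he, mem_Phi] at h1
  exact h1 rfl

lemma Phi_conn {n k : ℕ} (h : 2*k+1 ≤ n) (r : Fin k → Fin 3) :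
    (SimpleGraph.fromEdgeSet (Phi h r : Set (Sym2 (Fin n)))).Connected := by
  rw [SimpleGraph.connected_iff_exists_forall_reachable]
  refine ⟨vz h, ?_⟩
  have hA : ∀ u v : Fin n, u ≠ v → s(u,v) ∈ Phi h r → (SimpleGraph.fromEdgeSet (Phi h r : Set (Sym2 (Fin n)))).Reachable u v := by
    intro u v huv hm
    apply SimpleGraph.Adj.reachable
    rw [SimpleGraph.fromEdgeSet_adj]
    exact ⟨hm, huv⟩
  have hab : ∀ j, va h j ≠ vb h j := fun j => by simp [va, vb]
  have hza : ∀ j, vz h ≠ va h j := fun j => by simp [va, vz, Fin.ext_iff]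
  have hzb : ∀ j, vz h ≠ vb h j := fun j => by simp [vz, vb, Fin.ext_iff]
  have hj : ∀ j : Fin k, (SimpleGraph.fromEdgeSet (Phi h r : Set (Sym2 (Fin n)))).Reachable (vz h) (va h j) ∧ (SimpleGraph.fromEdgeSet (Phi h r : Set (Sym2 (Fin n)))).Reachable (vz h) (vb h j) := by
    intro j
    have m0 : 0 ≠ r j → s(va h j, vb h j) ∈ Phi h r := fun hh => (mem_Phi h r (j, 0)).2 hh
    have m1 : 1 ≠ r j → s(vz h, va h j) ∈ Phi h r := fun hh => (mem_Phi h r (j, 1)).2 hh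
    have m2 : 2 ≠ r j → s(vz h, vb h j) ∈ Phi h r := fun hh => (mem_Phi h r (j, 2)).2 hh
    generalize r j = c at m0 m1 m2
    fin_cases c
    · exact ⟨hA _ _ (hza j) (m1 (by simp)), hA _ _ (hzb j) (m2 (by simp))⟩
    · have e0 := hA _ _ (hab j) (m0 (by simp))
      have e2 := hA _ _ (hzb j) (m2 (by simp))
      exact ⟨e2.trans e0.symm, e2⟩
    · have e0 := hA _ _ (hab j) (m0 (by simp))
      have e1 := hA _ _ (hza j) (m1 (by simp))
      exact ⟨e1, e1.trans e0⟩
  intro v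
  by_cases hv : 2*k < v.1
  · apply hA
    · intro he; rw [← he] at hv; simp [vz] at hv
    · exact mem_union_left _ (mem_image.2 ⟨v, by simpa using hv, rfl⟩)
  · rcases Nat.eq_zero_or_pos v.1 with h0 | h0
    · have : v = vz h := Fin.ext h0
      rw [this]
    · rcases Nat.even_or_odd' v.1 with ⟨m, hm | hm⟩
      · have := (hj ⟨m-1, by omega⟩).2
        convert this
        ext; simp [vb]; omega
      · have := (hj ⟨m, by omega⟩).1
        convert this
        exact Fin.ext hm

lemma Phi_tree {n k : ℕ} (h : 2*k+1 ≤ n) (r : Fin k → Fin 3) : IsSpanningTree n (GG h) (Phi h r) :=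
  ⟨by rw [EE_edgeSet]; exact_mod_cast Phi_sub h r, Phi_conn h r, Phi_card h r⟩

lemma tree_cut {n k : ℕ} (h : 2*k+1 ≤ n) (T) (hT : IsSpanningTree n (GG h) T) (S : Set (Fin n)) (u v : Fin n)
    (hu : u ∈ S) (hv : v ∉ S) : ∃ a b, a ∈ S ∧ b ∉ S ∧ s(a,b) ∈ T := by
  obtain ⟨w⟩ := hT.2.1.preconnected u v
  obtain ⟨d, _, h1, h2⟩ := w.exists_boundary_dart S hu hv
  refine ⟨_, _, h1, h2, ?_⟩
  have := d.adj
  rw [SimpleGraph.fromEdgeSet_adj] at this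
  exact_mod_cast this.1

lemma tree_sub {n k : ℕ} (h : 2*k+1 ≤ n) (T) (hT : IsSpanningTree n (GG h) T) : T ⊆ EE h := by
  have := hT.1
  rw [EE_edgeSet] at this
  exact_mod_cast this

lemma EE_cases {n k : ℕ} (h : 2*k+1 ≤ n) {e} (he : e ∈ EE h) :
    (∃ v : Fin n, 2*k < v.1 ∧ e = s(vz h, v)) ∨ ∃ p, e = ed h p := by
  simp only [EE, mem_union, pend, mem_image, mem_filter, mem_univ, true_and] at he
  rcases he with ⟨v, hv, rfl⟩ | ⟨p, rfl⟩
  · exact Or.inl ⟨v, hv, rfl⟩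
  · exact Or.inr ⟨p, rfl⟩

lemma tree_pend {n k : ℕ} (h : 2*k+1 ≤ n) (T) (hT : IsSpanningTree n (GG h) T) : pend h ⊆ T := by
  intro e he
  simp only [pend, mem_image, mem_filter, mem_univ, true_and] at he
  obtain ⟨v, hv, rfl⟩ := he
  have hne : vz h ≠ v := by intro he; rw [← he] at hv; simp [vz] at hv
  obtain ⟨a, b, ha, hb, hab⟩ := tree_cut h T hT {v} v (vz h) rfl hne
  have ha' : a = v := ha
  subst ha'
  rcases EE_cases h (tree_sub h T hT hab) with ⟨w, hw, e⟩ | ⟨⟨j, c⟩, e⟩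
  · rw [Sym2.eq_iff] at e
    rcases e with ⟨e1, e2⟩ | ⟨e1, e2⟩
    · exact absurd e1.symm hne
    · rw [e2, Sym2.eq_swap] at hab; exact hab
  · exfalso
    have := j.2
    fin_cases c <;> simp [ed, va, vb, vz, Fin.ext_iff] at e <;> omega

/-- two different edges of one triangle form a cut -/
lemma tree_two {n k : ℕ} (h : 2*k+1 ≤ n) (T) (hT : IsSpanningTree n (GG h) T) (j : Fin k) (c d : Fin 3)
    (hcd : c ≠ d) : ed h (j, c) ∈ T ∨ ed h (j, d) ∈ T := by
  have key : ∀ S : Set (Fin n), va h j ∈ S ∨ vb h j ∈ S → vz h ∉ S → (∀ v ∈ S, v = va h j ∨ v = vb h j) →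
      ∃ c' : Fin 3, ed h (j, c') ∈ T ∧ ((c' = 0 ∧ ¬ (va h j ∈ S ∧ vb h j ∈ S)) ∨ (c' = 1 ∧ va h j ∈ S) ∨ (c' = 2 ∧ vb h j ∈ S)) := by
    intro S h1 h2 h3
    obtain ⟨u, hu⟩ : ∃ u, u ∈ S := by rcases h1 with h | h <;> exact ⟨_, h⟩
    obtain ⟨a, b, ha, hb, hab⟩ := tree_cut h T hT S u (vz h) hu h2
    rcases EE_cases h (tree_sub h T hT hab) with ⟨w, hw, e⟩ | ⟨⟨i, c⟩, e⟩
    · exfalso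
      have := j.2
      rcases h3 a ha with rfl | rfl <;>
      simp [va, vb, vz, Fin.ext_iff] at e <;> omega
    · have hij : i = j := by
        rcases h3 a ha with rfl | rfl <;> fin_cases c <;>
        simp [ed, va, vb, vz, Fin.ext_iff] at e ⊢ <;> omega
      subst hij
      refine ⟨c, e ▸ hab, ?_⟩
      fin_cases c
      · left
        refine ⟨rfl, ?_⟩
        rintro ⟨q1, q2⟩
        change s(a,b) = s(va h i, vb h i) at e
        rw [Sym2.eq_iff] at e
        rcases e with ⟨_, e2⟩ | ⟨_, e2⟩ <;> rw [e2] at hb <;> contradiction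
      · right; left
        refine ⟨rfl, ?_⟩
        change s(a,b) = s(vz h, va h i) at e
        rw [Sym2.eq_iff] at e
        rcases e with ⟨e1, e2⟩ | ⟨e1, e2⟩
        · rw [e1] at ha; contradiction
        · rw [e1] at ha; exact ha
      · right; right
        refine ⟨rfl, ?_⟩
        change s(a,b) = s(vz h, vb h i) at e
        rw [Sym2.eq_iff] at e
        rcases e with ⟨e1, e2⟩ | ⟨e1, e2⟩
        · rw [e1] at ha; contradiction
        · rw [e1] at ha; exact ha
  have hab : va h j ≠ vb h j := by simp [va, vb]
  have hza : vz h ≠ va h j := by simp [va, vz, Fin.ext_iff]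
  have hzb : vz h ≠ vb h j := by simp [vz, vb, Fin.ext_iff]
  obtain ⟨c1, m1, o1⟩ := key {va h j} (by simp) (by simpa using hza) (by simp)
  obtain ⟨c2, m2, o2⟩ := key {vb h j} (by simp) (by simpa using hzb) (by simp)
  obtain ⟨c3, m3, o3⟩ := key {va h j, vb h j} (by simp) (by simp [hza, hzb]) (by simp)
  simp only [Set.mem_singleton_iff, Set.mem_insert_iff, hab, hab.symm, true_or, or_true, and_false, and_true, or_false, not_true, not_false_iff, false_or, true_and] at o1 o2 o3
  by_contra hcon
  push Not at hcon
  obtain ⟨n1, n2⟩ := hcon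
  have hall : ∀ x y z c d : Fin 3, (x = 0 ∨ x = 1) → (y = 0 ∨ y = 2) → (z = 1 ∨ z = 2) → c ≠ d → x = c ∨ x = d ∨ y = c ∨ y = d ∨ z = c ∨ z = d := by decide
  rcases hall c1 c2 c3 c d o1 o2 o3 hcd with e | e | e | e | e | e <;> subst e <;> contradiction

lemma tree_Phi {n k : ℕ} (h : 2*k+1 ≤ n) (T) (hT : IsSpanningTree n (GG h) T) : ∃ r, Phi h r = T := by
  have hex : ∀ j, ∃ c, ∀ d, d ≠ c → ed h (j, d) ∈ T := by
    intro j
    by_cases hc : ∃ c, ed h (j, c) ∉ T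
    · obtain ⟨c, hc⟩ := hc
      exact ⟨c, fun d hd => (tree_two h T hT j d c hd).resolve_right hc⟩
    · push Not at hc
      exact ⟨0, fun d _ => hc d⟩
  choose r hr using hex
  refine ⟨r, Finset.eq_of_subset_of_card_le ?_ ?_⟩
  · apply Finset.union_subset (tree_pend h T hT)
    intro e he
    obtain ⟨⟨j, c⟩, hp, rfl⟩ := mem_image.1 he
    exact hr j c (by simpa using hp)
  · rw [hT.2.2, Phi_card]

lemma trees_eq {n k : ℕ} (h : 2*k+1 ≤ n) :
    univ.filter (fun T => IsSpanningTree n (GG h) T) = univ.image (Phi h) := by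
  ext T
  simp only [mem_filter, mem_univ, true_and, mem_image]
  exact ⟨tree_Phi h T, fun ⟨r, hr⟩ => hr ▸ Phi_tree h r⟩

lemma treeProb_Phi {n k : ℕ} (h : 2*k+1 ≤ n) (r) : treeProb n (GG h) 1 (Phi h r) = ((3:ℝ)^k)⁻¹ := by
  rw [treeProb, if_pos (Phi_tree h r), trees_eq, sum_image (fun a _ b _ hab => Phi_inj h hab)]
  simp [treeWt]

lemma treeProb_nonneg (n : ℕ) (G : SimpleGraph (Fin n)) (T) : 0 ≤ treeProb n G 1 T := by
  unfold treeProb treeWt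
  apply div_nonneg
  · split_ifs <;> simp
  · apply sum_nonneg; intros; simp

lemma lev_ed {n k : ℕ} (h : 2*k+1 ≤ n) (j : Fin k) (c : Fin 3) : lev n (GG h) 1 (ed h (j, c)) = 2/3 := by
  have e1 : univ.filter (fun T => IsSpanningTree n (GG h) T ∧ ed h (j, c) ∈ T)
      = (Fintype.piFinset (fun i => if i = j then univ.erase c else (univ : Finset (Fin 3)))).image (Phi h) := by
    ext T
    simp only [mem_filter, mem_univ, true_and, mem_image, Fintype.mem_piFinset]
    constructor
    · rintro ⟨hT, hm⟩
      obtain ⟨r, rfl⟩ := tree_Phi h T hT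
      rw [mem_Phi] at hm
      refine ⟨r, fun i => ?_, rfl⟩
      split_ifs with hi
      · subst hi; simpa using fun hh : r i = c => hm hh.symm
      · simp
    · rintro ⟨r, hr, rfl⟩
      refine ⟨Phi_tree h r, ?_⟩
      rw [mem_Phi]
      have := hr j
      rw [if_pos rfl, mem_erase] at this
      exact fun hh => this.1 hh.symm
  rw [lev, e1, sum_image (fun a _ b _ hab => Phi_inj h hab)]
  simp_rw [treeProb_Phi]
  rw [sum_const, Fintype.card_piFinset, nsmul_eq_mul]
  push_cast
  have e2 : ((3:ℝ)^k)⁻¹ = ∏ i : Fin k, (3:ℝ)⁻¹ := by simp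
  rw [e2, ← prod_mul_distrib]
  have e3 : ∀ i : Fin k, ((#(if i = j then univ.erase c else (univ : Finset (Fin 3))) : ℕ) : ℝ) * (3:ℝ)⁻¹ = if i = j then 2/3 else 1 := by
    intro i
    split_ifs with hi
    · rw [card_erase_of_mem (mem_univ _)]; simp; norm_num
    · simp
  rw [prod_congr rfl (fun i _ => e3 i), prod_ite_eq' univ j]
  simp

/-- quadratic form -/
def qf {n : ℕ} (x : Fin n → ℝ) (A : Matrix (Fin n) (Fin n) ℝ) : ℝ := x ⬝ᵥ A.mulVec x

lemma qf_add {n : ℕ} (x : Fin n → ℝ) (A B) : qf x (A + B) = qf x A + qf x B := by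
  simp [qf, Matrix.add_mulVec]
lemma qf_sub {n : ℕ} (x : Fin n → ℝ) (A B) : qf x (A - B) = qf x A - qf x B := by
  simp [qf, Matrix.sub_mulVec]
lemma qf_smul {n : ℕ} (x : Fin n → ℝ) (c : ℝ) (A) : qf x (c • A) = c * qf x A := by
  simp [qf, Matrix.smul_mulVec]
lemma qf_sum {n : ℕ} (x : Fin n → ℝ) {ι : Type} (S : Finset ι) (A : ι → Matrix (Fin n) (Fin n) ℝ) :
    qf x (∑ i ∈ S, A i) = ∑ i ∈ S, qf x (A i) := by
  simp [qf, Matrix.sum_mulVec, dotProduct_sum]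

lemma qf_psd {n : ℕ} (x : Fin n → ℝ) {A : Matrix (Fin n) (Fin n) ℝ} (h : A.PosSemidef) : 0 ≤ qf x A := by
  simpa [qf] using h.dotProduct_mulVec_nonneg x

lemma qf_edge {n : ℕ} (x : Fin n → ℝ) (u v : Fin n) (huv : u ≠ v) :
    qf x (edgeMat n s(u,v)) = (x u - x v)^2 := by
  have : edgeMat n s(u,v) = Matrix.vecMulVec (Pi.single u 1 - Pi.single v 1) (Pi.single u 1 - Pi.single v 1) := by
    ext i j
    simp only [edgeMat, Matrix.vecMulVec_apply, Pi.sub_apply, Pi.single_apply, Sym2.mem_iff]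
    by_cases h1 : i = u <;> by_cases h2 : i = v <;> by_cases h3 : j = u <;> by_cases h4 : j = v <;> by_cases h5 : i = j <;>
      simp_all
  rw [this, qf, Matrix.vecMulVec_mulVec]
  simp [dotProduct_sub, sub_dotProduct]
  ring

/-- test vector: the indicator of a plus sigma times the indicator of b -/
def tv {n k : ℕ} (h : 2*k+1 ≤ n) (j : Fin k) (σ : ℝ) : Fin n → ℝ :=
  fun v => if v = va h j then 1 else if v = vb h j then σ else 0

lemma tv_far {n k : ℕ} (h : 2*k+1 ≤ n) (j : Fin k) (σ : ℝ) (v : Fin n) (hv : v.1 ≠ 2*j.1+1) (hv2 : v.1 ≠ 2*j.1+2) :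
    tv h j σ v = 0 := by
  rw [tv, if_neg, if_neg]
  · intro e; exact hv2 (by rw [e]; rfl)
  · intro e; exact hv (by rw [e]; rfl)
lemma tv_a {n k : ℕ} (h : 2*k+1 ≤ n) (j : Fin k) (σ : ℝ) : tv h j σ (va h j) = 1 := by simp [tv]
lemma tv_b {n k : ℕ} (h : 2*k+1 ≤ n) (j : Fin k) (σ : ℝ) : tv h j σ (vb h j) = σ := by 
  rw [tv, if_neg (by simp [va, vb]), if_pos rfl]
lemma tv_z {n k : ℕ} (h : 2*k+1 ≤ n) (j : Fin k) (σ : ℝ) : tv h j σ (vz h) = 0 :=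
  tv_far h j σ _ (by simp [vz]) (by simp [vz])

lemma qf_ed {n k : ℕ} (h : 2*k+1 ≤ n) (j : Fin k) (σ : ℝ) (c : Fin 3) :
    qf (tv h j σ) (edgeMat n (ed h (j, c))) = ![(1-σ)^2, 1, σ^2] c := by
  have hab : va h j ≠ vb h j := by simp [va, vb]
  have hza : vz h ≠ va h j := by simp [va, vz, Fin.ext_iff]
  have hzb : vz h ≠ vb h j := by simp [vz, vb, Fin.ext_iff]
  fin_cases c
  · change qf _ (edgeMat n s(va h j, vb h j)) = (1-σ)^2
    rw [qf_edge _ _ _ hab, tv_a, tv_b]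
  · change qf _ (edgeMat n s(vz h, va h j)) = 1
    rw [qf_edge _ _ _ hza, tv_a, tv_z]; norm_num
  · change qf _ (edgeMat n s(vz h, vb h j)) = σ^2
    rw [qf_edge _ _ _ hzb, tv_b, tv_z]; ring

lemma qf_pend {n k : ℕ} (h : 2*k+1 ≤ n) (j : Fin k) (σ : ℝ) (e) (he : e ∈ pend h) :
    qf (tv h j σ) (edgeMat n e) = 0 := by
  simp only [pend, mem_image, mem_filter, mem_univ, true_and] at he
  obtain ⟨v, hv, rfl⟩ := he
  have := j.2
  have hne : vz h ≠ v := by intro he; rw [← he] at hv; simp [vz] at hv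
  rw [qf_edge _ _ _ hne, tv_z, tv_far h j σ v (by omega) (by omega)]; norm_num

lemma qf_ed_far {n k : ℕ} (h : 2*k+1 ≤ n) (j i : Fin k) (hij : i ≠ j) (σ : ℝ) (c : Fin 3) :
    qf (tv h j σ) (edgeMat n (ed h (i, c))) = 0 := by
  have hab : va h i ≠ vb h i := by simp [va, vb]
  have hza : vz h ≠ va h i := by simp [va, vz, Fin.ext_iff]
  have hzb : vz h ≠ vb h i := by simp [vz, vb, Fin.ext_iff]
  have hij' : i.1 ≠ j.1 := fun e => hij (Fin.ext e)
  have a0 := tv_far h j σ (va h i) (by simp [va]; omega) (by simp [va]; omega)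
  have b0 := tv_far h j σ (vb h i) (by simp [vb]; omega) (by simp [vb]; omega)
  fin_cases c
  · change qf _ (edgeMat n s(va h i, vb h i)) = 0
    rw [qf_edge _ _ _ hab, a0, b0]; norm_num
  · change qf _ (edgeMat n s(vz h, va h i)) = 0
    rw [qf_edge _ _ _ hza, a0, tv_z]; norm_num
  · change qf _ (edgeMat n s(vz h, vb h i)) = 0
    rw [qf_edge _ _ _ hzb, b0, tv_z]; norm_num

lemma qf_lap {n k : ℕ} (h : 2*k+1 ≤ n) (j : Fin k) (σ : ℝ) :
    qf (tv h j σ) (lap n (GG h) 1) = (1-σ)^2 + 1 + σ^2 := by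
  rw [lap, qf_sum]
  simp_rw [qf_smul, EE_edgeSet, mem_coe, Pi.one_apply, ite_mul, one_mul, zero_mul]
  rw [← sum_filter, filter_mem_eq_inter, univ_inter, EE, sum_union (disj_pend h _),
    sum_eq_zero (fun e he => qf_pend h j σ e he), zero_add, sum_image (fun a _ b _ hab => ed_inj h hab),
    Fintype.sum_prod_type, sum_eq_single j]
  · simp_rw [qf_ed]; simp [Fin.sum_univ_three]
  · intro i _ hij
    exact sum_eq_zero (fun c _ => qf_ed_far h j i hij σ c)
  · simp

lemma qf_treeLap {n k : ℕ} (h : 2*k+1 ≤ n) (j : Fin k) (σ : ℝ) (r : Fin k → Fin 3) :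
    qf (tv h j σ) (treeLap n (GG h) 1 (Phi h r)) =
      3/2 * ((1-σ)^2 + 1 + σ^2 - ![(1-σ)^2, 1, σ^2] (r j)) := by
  rw [treeLap, qf_sum]
  simp_rw [qf_smul]
  rw [Phi, sum_union (disj_pend h _),
    sum_eq_zero (fun e he => by rw [qf_pend h j σ e he, mul_zero]), zero_add, sum_image (fun a _ b _ hab => ed_inj h hab),
    sum_filter, Fintype.sum_prod_type, sum_eq_single j]
  · simp_rw [qf_ed, lev_ed]
    generalize r j = c
    fin_cases c <;> simp [Fin.sum_univ_three] <;> ring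
  · intro i _ hij
    exact sum_eq_zero (fun c _ => by rw [qf_ed_far h j i hij σ c]; simp)
  · simp

lemma bad_event {n k t : ℕ} (h : 2*k+1 ≤ n) (ht : 0 < t) (ε : ℝ) (R : Fin t → Fin k → Fin 3) (j : Fin k)
    (hj : (t:ℝ) * (1/3 + 4*ε/3) < (univ.filter (fun i => R i j = 0)).card) :
    ¬ ((t : ℝ)⁻¹ • ∑ i, treeLap n (GG h) 1 (Phi h (R i)) - (1 - ε) • lap n (GG h) 1).PosSemidef ∧
    ¬ ((1 + ε) • lap n (GG h) 1 - (t : ℝ)⁻¹ • ∑ i, treeLap n (GG h) 1 (Phi h (R i))).PosSemidef := by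
  have htr : (0:ℝ) < t := by exact_mod_cast ht
  set m : ℝ := ((univ.filter (fun i => R i j = 0)).card : ℝ) with hm
  have hm' : m = ∑ i : Fin t, if R i j = 0 then (1:ℝ) else 0 := by
    rw [hm, card_filter]; push_cast; rfl
  have hlow : ∑ i : Fin t, qf (tv h j (-1)) (treeLap n (GG h) 1 (Phi h (R i))) = 15/2 * t - 9/2 * m := by
    have : ∀ i : Fin t, qf (tv h j (-1)) (treeLap n (GG h) 1 (Phi h (R i))) = 15/2 - 9/2 * (if R i j = 0 then (1:ℝ) else 0) := by
      intro i
      rw [qf_treeLap]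
      generalize R i j = c
      fin_cases c <;> simp <;> norm_num
    simp_rw [this]
    rw [sum_sub_distrib, ← mul_sum, ← hm']
    simp [mul_comm]
  have hup : ∑ i : Fin t, qf (tv h j 1) (treeLap n (GG h) 1 (Phi h (R i))) = 3/2 * t + 3/2 * m := by
    have : ∀ i : Fin t, qf (tv h j 1) (treeLap n (GG h) 1 (Phi h (R i))) = 3/2 + 3/2 * (if R i j = 0 then (1:ℝ) else 0) := by
      intro i
      rw [qf_treeLap]
      generalize R i j = c
      fin_cases c <;> simp <;> norm_num
    simp_rw [this]
    rw [sum_add_distrib, ← mul_sum, ← hm']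
    simp [mul_comm]
  constructor
  · intro hp
    have := qf_psd (tv h j (-1)) hp
    rw [qf_sub, qf_smul, qf_smul, qf_sum, hlow, qf_lap] at this
    have h2 := mul_nonneg htr.le this
    have e : (t:ℝ) * ((t:ℝ)⁻¹ * (15/2*t - 9/2*m) - (1-ε) * ((1 - -1)^2+1+(-1)^2)) = (15/2*t - 9/2*m) - t * (1-ε) * 6 := by
      field_simp; ring
    rw [e] at h2
    nlinarith
  · intro hp
    have := qf_psd (tv h j 1) hp
    rw [qf_sub, qf_smul, qf_smul, qf_sum, hup, qf_lap] at this
    have h2 := mul_nonneg htr.le this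
    have e : (t:ℝ) * ((1+ε) * ((1 - 1)^2+1+1^2) - (t:ℝ)⁻¹ * (3/2*t + 3/2*m)) = t * (1+ε) * 2 - (3/2*t + 3/2*m) := by
      field_simp; ring
    rw [e] at h2
    nlinarith

lemma count_lemma (t M : ℕ) :
    (univ.filter (fun s : Fin t → Fin 3 => (univ.filter (fun i => s i = 0)).card = M)).card = t.choose M * 2^(t-M) := by
  have hc := Finset.card_eq_sum_card_fiberwise (f := fun s : Fin t → Fin 3 => univ.filter (fun i => s i = 0))
      (s := univ.filter (fun s : Fin t → Fin 3 => (univ.filter (fun i => s i = 0)).card = M))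
      (t := powersetCard M univ) (fun s hs => by simpa [mem_powersetCard] using hs)
  rw [hc]
  have : ∀ S ∈ powersetCard M (univ : Finset (Fin t)), (filter (fun s : Fin t → Fin 3 => univ.filter (fun i => s i = 0) = S)
      (univ.filter (fun s : Fin t → Fin 3 => (univ.filter (fun i => s i = 0)).card = M))).card = 2^(t-M) := by
    intro S hS
    rw [mem_powersetCard] at hS
    have e : filter (fun s : Fin t → Fin 3 => univ.filter (fun i => s i = 0) = S)
      (univ.filter (fun s : Fin t → Fin 3 => (univ.filter (fun i => s i = 0)).card = M)) =
      Fintype.piFinset (fun i => if i ∈ S then {0} else univ.erase (0 : Fin 3)) := by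
      ext s
      simp only [mem_filter, mem_univ, true_and, Fintype.mem_piFinset]
      constructor
      · rintro ⟨_, rfl⟩ i
        by_cases hi : s i = 0 <;> simp [hi]
      · intro hs
        have : univ.filter (fun i => s i = 0) = S := by
          ext i
          have := hs i
          by_cases hi : i ∈ S <;> simp [hi] at this ⊢ <;> exact this
        exact ⟨by rw [this]; exact hS.2, this⟩
    rw [e, Fintype.card_piFinset]
    have e2 : ∀ i : Fin t, #(if i ∈ S then {0} else univ.erase (0 : Fin 3)) = if i ∈ S then 1 else 2 := by
      intro i; split_ifs
      · simp
      · rw [card_erase_of_mem (mem_univ _)]; simp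
    rw [prod_congr rfl (fun i _ => e2 i), prod_ite]
    simp only [prod_const, one_pow, one_mul]
    congr 1
    have : univ.filter (fun i => i ∉ S) = Sᶜ := by ext; simp
    rw [this, card_compl, hS.2, Fintype.card_fin]
  rw [sum_congr rfl this, sum_const, card_powersetCard]
  simp

/-- number of sample arrays in which every block avoids `A` -/
lemma avoid_card (t k : ℕ) (A : Finset (Fin t → Fin 3)) :
    (univ.filter (fun R : Fin t → Fin k → Fin 3 => ∀ j, (fun i => R i j) ∉ A)).card = (3^t - A.card)^k := by
  have e : (univ.filter (fun R : Fin t → Fin k → Fin 3 => ∀ j, (fun i => R i j) ∉ A)).card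
      = (Fintype.piFinset (fun _ : Fin k => Aᶜ)).card := by
    apply Finset.card_bij (fun R _ => fun j i => R i j)
    · intro R hR
      simpa [Fintype.mem_piFinset] using hR
    · intro R _ R' _ he
      funext i j
      exact congrFun (congrFun he j) i
    · intro Q hQ
      refine ⟨fun i j => Q j i, ?_, rfl⟩
      simpa [Fintype.mem_piFinset] using hQ
  rw [e, Fintype.card_piFinset_const, card_compl]
  simp

theorem multiple_spanning_trees_lower_bound :
    ∀ n : ℕ, 2 ^ 100 ≤ n →
    ∃ G : SimpleGraph (Fin n), G.Connected ∧
      ∀ ε : ℝ, 5 * (n : ℝ) ^ (-(0.1 : ℝ)) < ε → ε < 1 / 2 →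
      ∀ t : ℕ, t = ⌊0.05 * ε⁻¹ ^ 2 * Real.logb 2 n⌋₊ →
      1 - Real.exp (-(n : ℝ) ^ (0.39 : ℝ)) ≤
        ∑ Ts ∈ Finset.univ.filter (fun Ts : Fin t → Finset (Sym2 (Fin n)) =>
          ¬ ((t : ℝ)⁻¹ • ∑ i, treeLap n G 1 (Ts i) - (1 - ε) • lap n G 1).PosSemidef ∧
          ¬ ((1 + ε) • lap n G 1 - (t : ℝ)⁻¹ • ∑ i, treeLap n G 1 (Ts i)).PosSemidef),
          ∏ i, treeProb n G 1 (Ts i) := by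
  intro n hn
  have hn1 : 1 ≤ n := le_trans (Nat.one_le_two_pow) hn
  obtain ⟨k, hk1, hk2⟩ : ∃ k, 2*k+1 ≤ n ∧ n ≤ 2*k+2 := ⟨(n-1)/2, by omega, by omega⟩
  refine ⟨GG hk1, ?_, ?_⟩
  · have := Phi_conn hk1 (fun _ => 0)
    refine this.mono ?_
    exact SimpleGraph.fromEdgeSet_mono (by exact_mod_cast Phi_sub hk1 _)
  intro ε h1 h2 t ht
  obtain ⟨ht0, M, hMt, hM, hq⟩ := aux_final n k t ε hn hk2 h1 h2 ht
  clear ht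
  set A : Finset (Fin t → Fin 3) := univ.filter (fun s : Fin t → Fin 3 => (univ.filter (fun i => s i = 0)).card = M) with hA
  have hAc : A.card = t.choose M * 2^(t-M) := count_lemma t M
  have hAle : A.card ≤ 3^t := by
    have := card_le_univ A
    simpa using this
  set good : Finset (Fin t → Fin k → Fin 3) := univ.filter (fun R => ¬ ∀ j, (fun i => R i j) ∉ A) with hgood
  have hcard : (good.card : ℝ) = ((3:ℝ)^k)^t - ((3:ℝ)^t - A.card)^k := by
    have h3 := card_filter_add_card_filter_not (s := (univ : Finset (Fin t → Fin k → Fin 3))) (fun R => ∀ j, (fun i => R i j) ∉ A)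
    rw [avoid_card] at h3
    have h4 : (((3^t - A.card : ℕ)^k + good.card : ℕ) : ℝ) = ((3:ℝ)^k)^t := by
      rw [h3]; simp
    push_cast [hAle] at h4
    linarith
  have hsub : good.image (fun R i => Phi hk1 (R i)) ⊆ Finset.univ.filter (fun Ts : Fin t → Finset (Sym2 (Fin n)) =>
          ¬ ((t : ℝ)⁻¹ • ∑ i, treeLap n (GG hk1) 1 (Ts i) - (1 - ε) • lap n (GG hk1) 1).PosSemidef ∧
          ¬ ((1 + ε) • lap n (GG hk1) 1 - (t : ℝ)⁻¹ • ∑ i, treeLap n (GG hk1) 1 (Ts i)).PosSemidef) := by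
    intro Ts hTs
    obtain ⟨R, hR, rfl⟩ := mem_image.1 hTs
    rw [hgood, mem_filter] at hR
    have := hR.2
    push Not at this
    obtain ⟨j, hj⟩ := this
    rw [hA, mem_filter] at hj
    rw [mem_filter]
    refine ⟨mem_univ _, bad_event hk1 ht0 ε R j ?_⟩
    rw [hj.2]; exact hM
  refine le_trans ?_ (sum_le_sum_of_subset_of_nonneg hsub (fun Ts _ _ => prod_nonneg (fun i _ => treeProb_nonneg _ _ _)))
  rw [sum_image]
  swap
  · intro R _ R' _ he
    funext i
    exact Phi_inj hk1 (congrFun he i)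
  simp_rw [treeProb_Phi]
  rw [sum_const, prod_const, nsmul_eq_mul, hcard, card_univ, Fintype.card_fin]
  set q : ℝ := t.choose M * 2^(t-M) / 3^t with hqdef
  have hAq : (A.card : ℝ) = q * 3^t := by
    rw [hAc, hqdef]; push_cast; field_simp
  have hq1 : q ≤ 1 := by
    have h5 : (A.card : ℝ) ≤ 3^t := by exact_mod_cast hAle
    rw [hAq] at h5
    have h6 : (0:ℝ) < 3^t := by positivity
    nlinarith
  have e : (((3:ℝ)^k)^t - ((3:ℝ)^t - A.card)^k) * (((3:ℝ)^k)⁻¹)^t = 1 - (1-q)^k := by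
    have : (3:ℝ)^t - A.card = 3^t * (1-q) := by rw [hAq]; ring
    rw [this, mul_pow, ← pow_mul, ← pow_mul, inv_pow, ← pow_mul, mul_comm t k]
    field_simp
  rw [e]
  apply sub_le_sub_left
  calc (1-q)^k ≤ (Real.exp (-q))^k := by
        apply pow_le_pow_left₀ (by linarith)
        have := Real.add_one_le_exp (-q); linarith
    _ = Real.exp (-(k*q)) := by rw [← Real.exp_nat_mul]; ring_nf
    _ ≤ _ := by rw [Real.exp_le_exp]; linarith

end
end

section
/- Suppose (ξ_1, …, ξ_m) ∈ {0,1}^m is a random vector whose distribution is k-homogeneous and Strongly Rayleigh. Then for any set S ⊆ [m] with |S| ≤ k such that Pr[ξ_S = 1_S] > 0 (where ξ_S = 1_S means ξ_i = 1 for all i ∈ S), and for every j ∈ [m] \ S, Pr[ ξ_j = 1 | ξ_S = 1_S ] ≤ Pr[ ξ_j = 1 ]. -/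
open Matrix Finset
attribute [local instance] Classical.propDecidable

noncomputable section

theorem im_nonneg_of_no_root (A B : ℂ) (h : ∀ t : ℂ, 0 < t.im → A + t * B ≠ 0) :
    0 ≤ (A * (starRingEnd ℂ) B).im := by
  by_contra hneg
  push Not at hneg
  have hB : B ≠ 0 := by
    rintro rfl
    simp at hneg
  refine h (-A / B) ?_ (by field_simp; ring)
  have hn : 0 < Complex.normSq B := Complex.normSq_pos.mpr hB
  have : (-A / B).im = -(A * (starRingEnd ℂ) B).im / Complex.normSq B := by
    rw [Complex.div_im]
    simp
    ring
  rw [this]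
  exact div_pos (by linarith) hn

/-- Numerator weights: `I` at `i`, `t` at `j`, and `1 + ε I` elsewhere. -/
def xw {m : ℕ} (i j : Fin m) (t : ℂ) (ε : ℝ) (l : Fin m) : ℂ :=
  if l = j then t else if l = i then Complex.I else 1 + ε * Complex.I

/-- Denominator weights: `ε` on `S`. -/
def yw {m : ℕ} (S : Finset (Fin m)) (ε : ℝ) (l : Fin m) : ℂ :=
  if l ∈ S then (ε : ℂ) else 1

/-- Weight of a configuration with the coordinate `j` left out. -/
def cw {m : ℕ} (S : Finset (Fin m)) (i j : Fin m) (ε : ℝ) (ξ : Fin m → Bool) : ℂ :=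
  ∏ l ∈ Finset.univ.erase j, if ξ l = true then xw i j 0 ε l else yw S ε l

theorem cw_zero {m : ℕ} (S : Finset (Fin m)) (i j : Fin m) (hij : i ≠ j) (hi : i ∉ S) (hj : j ∉ S)
    (ξ : Fin m → Bool) :
    cw S i j 0 ξ = if ∀ l ∈ S, ξ l = true then (if ξ i = true then Complex.I else 1) else 0 := by
  unfold cw
  split_ifs with h h2
  · rw [← Finset.mul_prod_erase _ _ (show i ∈ Finset.univ.erase j by simp [hij]),
      Finset.prod_eq_one]
    · simp [h2, xw, hij]
    · intro l hl
      simp only [Finset.mem_erase, Finset.mem_univ, and_true] at hl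
      by_cases hl2 : ξ l = true
      · simp [hl2, xw, hl]
      · have : l ∉ S := fun hS => hl2 (h l hS)
        simp [hl2, yw, this]
  · apply Finset.prod_eq_one
    intro l hl
    simp only [Finset.mem_erase, Finset.mem_univ, and_true] at hl
    by_cases hl2 : ξ l = true
    · have : l ≠ i := by
        rintro rfl
        exact h2 hl2
      simp [hl2, xw, hl, this]
    · have : l ∉ S := fun hS => hl2 (h l hS)
      simp [hl2, yw, this]
  · push Not at h
    obtain ⟨l, hl, hl2⟩ := h
    apply Finset.prod_eq_zero (i := l)
    · simp only [Finset.mem_erase, Finset.mem_univ, and_true]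
      rintro rfl
      exact hj hl
    · simp [hl2, yw, hl]

theorem cw_continuous {m : ℕ} (S : Finset (Fin m)) (i j : Fin m) (ξ : Fin m → Bool) :
    Continuous (fun ε : ℝ => cw S i j ε ξ) := by
  unfold cw
  apply continuous_finsetProd
  intro l _
  unfold xw yw
  split_ifs <;> fun_prop

theorem im_eps {m : ℕ} (π : (Fin m → Bool) → ℝ) (hSR : StronglyRayleigh m π)
    (S : Finset (Fin m)) (i j : Fin m) (hi : i ∉ S) (hj : j ∉ S)
    (ε : ℝ) (hε : 0 < ε) :
    0 ≤ ((∑ ξ, if ξ j = true then 0 else (π ξ : ℂ) * cw S i j ε ξ) *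
      (starRingEnd ℂ) (∑ ξ, if ξ j = true then (π ξ : ℂ) * cw S i j ε ξ else 0)).im := by
  apply im_nonneg_of_no_root
  intro t ht hzero
  have hεc : (ε : ℂ) ≠ 0 := by exact_mod_cast hε.ne'
  have hy : ∀ l, yw S ε l ≠ 0 := by
    intro l
    unfold yw
    split_ifs
    · exact hεc
    · exact one_ne_zero
  apply hSR (fun l => xw i j t ε l / yw S ε l)
  · intro l
    by_cases hl : l ∈ S
    · have h1 : l ≠ j := fun h => hj (h ▸ hl)
      have h2 : l ≠ i := fun h => hi (h ▸ hl)
      simp only [xw, yw, hl, h1, h2, if_true, if_false]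
      rw [Complex.div_ofReal_im]
      simp [hε.ne']
    · simp only [yw, hl, if_false, div_one, xw]
      split_ifs
      · exact ht
      · simp
      · simpa using hε
  · have key : ∀ ξ : Fin m → Bool,
        (∏ l, yw S ε l) * ((π ξ : ℂ) *
          ∏ l ∈ Finset.univ.filter (fun l => ξ l = true), xw i j t ε l / yw S ε l) =
        (if ξ j = true then 0 else (π ξ : ℂ) * cw S i j ε ξ) +
          t * (if ξ j = true then (π ξ : ℂ) * cw S i j ε ξ else 0) := by
      intro ξ
      have h1 : (∏ l, yw S ε l) *
          ∏ l ∈ Finset.univ.filter (fun l => ξ l = true), xw i j t ε l / yw S ε l =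
          ∏ l, if ξ l = true then xw i j t ε l else yw S ε l := by
        rw [Finset.prod_filter, ← Finset.prod_mul_distrib]
        apply Finset.prod_congr rfl
        intro l _
        split_ifs
        · exact mul_div_cancel₀ _ (hy l)
        · simp
      have h2 : (∏ l, if ξ l = true then xw i j t ε l else yw S ε l) =
          (if ξ j = true then t else 1) * cw S i j ε ξ := by
        rw [← Finset.mul_prod_erase _ _ (Finset.mem_univ j)]
        congr 1
        · simp [xw, yw, hj]
        · unfold cw
          apply Finset.prod_congr rfl
          intro l hl
          have := Finset.ne_of_mem_erase hl
          simp [xw, this]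
      rw [mul_left_comm, h1, h2]
      split_ifs <;> ring
    have hsum := Finset.sum_congr (rfl : (Finset.univ : Finset (Fin m → Bool)) = _)
      (fun ξ _ => key ξ)
    rw [← Finset.mul_sum, Finset.sum_add_distrib, ← Finset.mul_sum, hzero] at hsum
    exact (mul_eq_zero.mp hsum).resolve_left (Finset.prod_ne_zero_iff.mpr fun l _ => hy l)

/-- Total mass of an event. -/
def mass {m : ℕ} (π : (Fin m → Bool) → ℝ) (p : (Fin m → Bool) → Prop) : ℝ :=
  ∑ ξ, if p ξ then π ξ else 0

theorem rayleigh {m : ℕ} (π : (Fin m → Bool) → ℝ) (hSR : StronglyRayleigh m π)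
    (S : Finset (Fin m)) (i j : Fin m) (hij : i ≠ j) (hi : i ∉ S) (hj : j ∉ S) :
    mass π (fun ξ => ξ j = true ∧ ξ i = true ∧ ∀ l ∈ S, ξ l = true) *
      mass π (fun ξ => ∀ l ∈ S, ξ l = true) ≤
    mass π (fun ξ => ξ i = true ∧ ∀ l ∈ S, ξ l = true) *
      mass π (fun ξ => ξ j = true ∧ ∀ l ∈ S, ξ l = true) := by
  have h0 : 0 ≤ ((∑ ξ, if ξ j = true then 0 else (π ξ : ℂ) * cw S i j 0 ξ) *
      (starRingEnd ℂ) (∑ ξ, if ξ j = true then (π ξ : ℂ) * cw S i j 0 ξ else 0)).im := by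
    have hc : Continuous (fun ε : ℝ =>
        ((∑ ξ, if ξ j = true then 0 else (π ξ : ℂ) * cw S i j ε ξ) *
      (starRingEnd ℂ) (∑ ξ, if ξ j = true then (π ξ : ℂ) * cw S i j ε ξ else 0)).im) := by
      have := cw_continuous S i j
      refine Complex.continuous_im.comp (Continuous.mul ?_ (Complex.continuous_conj.comp ?_))
      · apply continuous_finsetSum
        intro ξ _
        split_ifs
        · exact continuous_const
        · exact continuous_const.mul (this ξ)
      · apply continuous_finsetSum
        intro ξ _
        split_ifs
        · exact continuous_const.mul (this ξ)
        · exact continuous_const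
    refine ge_of_tendsto ((hc.tendsto 0).mono_left (nhdsWithin_le_nhds (s := Set.Ioi 0))) ?_
    filter_upwards [self_mem_nhdsWithin] with ε hε
    exact im_eps π hSR S i j hi hj ε hε
  set a := mass π (fun ξ => ¬ ξ j = true ∧ ¬ ξ i = true ∧ ∀ l ∈ S, ξ l = true) with ha
  set b := mass π (fun ξ => ¬ ξ j = true ∧ ξ i = true ∧ ∀ l ∈ S, ξ l = true) with hb
  set c := mass π (fun ξ => ξ j = true ∧ ¬ ξ i = true ∧ ∀ l ∈ S, ξ l = true) with hc
  set d := mass π (fun ξ => ξ j = true ∧ ξ i = true ∧ ∀ l ∈ S, ξ l = true) with hd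
  have e1 : mass π (fun ξ => ∀ l ∈ S, ξ l = true) = a + b + c + d := by
    simp only [ha, hb, hc, hd, mass, ← Finset.sum_add_distrib]
    apply Finset.sum_congr rfl
    intro ξ _
    by_cases h1 : ξ j = true <;> by_cases h2 : ξ i = true <;> simp [h1, h2]
  have e2 : mass π (fun ξ => ξ i = true ∧ ∀ l ∈ S, ξ l = true) = b + d := by
    simp only [hb, hd, mass, ← Finset.sum_add_distrib]
    apply Finset.sum_congr rfl
    intro ξ _
    by_cases h1 : ξ j = true <;> by_cases h2 : ξ i = true <;> simp [h1, h2]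
  have e3 : mass π (fun ξ => ξ j = true ∧ ∀ l ∈ S, ξ l = true) = c + d := by
    simp only [hc, hd, mass, ← Finset.sum_add_distrib]
    apply Finset.sum_congr rfl
    intro ξ _
    by_cases h1 : ξ j = true <;> by_cases h2 : ξ i = true <;> simp [h1, h2]
  have eA : (∑ ξ, if ξ j = true then 0 else (π ξ : ℂ) * cw S i j 0 ξ) =
      (a : ℂ) + (b : ℂ) * Complex.I := by
    simp only [ha, hb, mass, Complex.ofReal_sum, Finset.sum_mul, ← Finset.sum_add_distrib]
    apply Finset.sum_congr rfl
    intro ξ _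
    rw [cw_zero S i j hij hi hj]
    by_cases h1 : ξ j = true <;> by_cases h2 : ξ i = true <;>
      by_cases h3 : ∀ l ∈ S, ξ l = true <;> (first | simp only [h1, h2, if_pos h3] | simp only [h1, h2, if_neg h3]) <;> simp [h3] <;>
      (intro x hx hf; simp [h3 x hx] at hf)
  have eB : (∑ ξ, if ξ j = true then (π ξ : ℂ) * cw S i j 0 ξ else 0) =
      (c : ℂ) + (d : ℂ) * Complex.I := by
    simp only [hc, hd, mass, Complex.ofReal_sum, Finset.sum_mul, ← Finset.sum_add_distrib]
    apply Finset.sum_congr rfl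
    intro ξ _
    rw [cw_zero S i j hij hi hj]
    by_cases h1 : ξ j = true <;> by_cases h2 : ξ i = true <;>
      by_cases h3 : ∀ l ∈ S, ξ l = true <;> (first | simp only [h1, h2, if_pos h3] | simp only [h1, h2, if_neg h3]) <;> simp [h3] <;>
      (intro x hx hf; simp [h3 x hx] at hf)
  rw [eA, eB] at h0
  simp at h0
  rw [e1, e2, e3]
  nlinarith

theorem mass_mono {m : ℕ} (π : (Fin m → Bool) → ℝ) (hπ0 : ∀ ξ, 0 ≤ π ξ)
    (p q : (Fin m → Bool) → Prop) (h : ∀ ξ, p ξ → q ξ) : mass π p ≤ mass π q := by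
  apply Finset.sum_le_sum
  intro ξ _
  have := hπ0 ξ
  by_cases h1 : p ξ
  · simp [h1, h ξ h1]
  · simp only [h1, if_false]
    split_ifs <;> simp [this]

theorem mass_main {m : ℕ} (π : (Fin m → Bool) → ℝ) (hπ0 : ∀ ξ, 0 ≤ π ξ) (hπ1 : ∑ ξ, π ξ = 1)
    (hSR : StronglyRayleigh m π) (j : Fin m) (S : Finset (Fin m)) :
    j ∉ S → 0 < mass π (fun ξ => ∀ l ∈ S, ξ l = true) →
    mass π (fun ξ => ξ j = true ∧ ∀ l ∈ S, ξ l = true) ≤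
      mass π (fun ξ => ∀ l ∈ S, ξ l = true) * mass π (fun ξ => ξ j = true) := by
  induction S using Finset.induction_on with
  | empty =>
    intro _ _
    simp only [mass, Finset.notMem_empty, false_imp_iff, implies_true, and_true, if_true, hπ1,
      one_mul]
    apply le_of_eq
    apply Finset.sum_congr rfl
    intro ξ _
    by_cases h1 : ξ j = true <;> simp [h1]
  | insert i S hi ih =>
    intro hj hp
    rw [Finset.mem_insert, not_or] at hj
    simp only [Finset.forall_mem_insert] at hp ⊢
    have hpS : 0 < mass π (fun ξ => ∀ l ∈ S, ξ l = true) :=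
      hp.trans_le (mass_mono π hπ0 _ _ fun ξ h => h.2)
    have h1 := rayleigh π hSR S i j (Ne.symm hj.1) hi hj.2
    have h2 := mul_le_mul_of_nonneg_left (ih hj.2 hpS) hp.le
    refine le_of_mul_le_mul_right ?_ hpS
    linarith

/-- Shrinking Marginals for k-homogeneous Strongly Rayleigh distributions. -/
theorem shrinking_marginals {m k : ℕ}
    (π : (Fin m → Bool) → ℝ) (hπ0 : ∀ ξ, 0 ≤ π ξ) (hπ1 : ∑ ξ, π ξ = 1)
    (hhom : kHomogeneous m k π) (hSR : StronglyRayleigh m π)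
    (S : Finset (Fin m)) (hS : S.card ≤ k)
    (hpos : 0 < ∑ ξ ∈ Finset.univ.filter (fun ξ : Fin m → Bool => ∀ i ∈ S, ξ i = true), π ξ)
    (j : Fin m) (hj : j ∉ S) :
    (∑ ξ ∈ Finset.univ.filter
        (fun ξ : Fin m → Bool => ξ j = true ∧ ∀ i ∈ S, ξ i = true), π ξ) /
      (∑ ξ ∈ Finset.univ.filter (fun ξ : Fin m → Bool => ∀ i ∈ S, ξ i = true), π ξ)
    ≤ ∑ ξ ∈ Finset.univ.filter (fun ξ : Fin m → Bool => ξ j = true), π ξ := by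
  have h := mass_main π hπ0 hπ1 hSR j S hj
  have e : ∀ (p : (Fin m → Bool) → Prop) [DecidablePred p],
      ∑ ξ ∈ Finset.univ.filter p, π ξ = mass π p := by
    intro p _
    rw [Finset.sum_filter]
    apply Finset.sum_congr rfl
    intro ξ _
    by_cases h1 : p ξ <;> simp [h1]
  rw [div_le_iff₀ hpos, mul_comm]
  rw [e] at hpos
  rw [e, e, e]
  exact h hpos

end
end

section
/- Let (ξ_1, …, ξ_m) ∈ {0,1}^m be a random vector whose distribution is k-homogeneous and Strongly Rayleigh, let Y_1, …, Y_m be real symmetric positive semidefinite n×n matrices, and let μ ≥ 0 be such that Σ_{e∈[m]} Pr[ξ_e = 1]·Y_e ⪯ μ·I. Then for every set S ⊆ [m] with |S| ≤ k − 1 and Pr[ξ_S = 1_S] > 0 (where ξ_S = 1_S means ξ_i = 1 for all i ∈ S), it holds that Σ_{e∈[m]\S} Pr[ ξ_e = 1 | ξ_S = 1_S ]·Y_e ⪯ μ·I. -/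
open Matrix Finset
attribute [local instance] Classical.propDecidable

noncomputable section

lemma rayleigh_core (a b c d : ℝ → ℂ) (ha : Continuous a) (hb : Continuous b)
    (hc : Continuous c) (hd : Continuous d) (a0 b0 c0 d0 : ℝ)
    (ha0 : a 0 = a0) (hb0 : b 0 = b0) (hc0 : c 0 = c0) (hd0 : d 0 = d0)
    (h : ∀ ε : ℝ, 0 < ε → ∀ u v : ℂ, 0 < u.im → 0 < v.im →
      a ε + b ε * u + c ε * v + d ε * (u * v) ≠ 0) : a0 * d0 ≤ b0 * c0 := by
  by_contra! hlt
  have hden : c 0 + d 0 * Complex.I ≠ 0 := by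
    intro h0
    rw [hc0, hd0] at h0
    have h1 := congrArg Complex.re h0
    have h2 := congrArg Complex.im h0
    simp at h1 h2
    rw [h1, h2] at hlt
    simp at hlt
  have hcont : ContinuousAt (fun ε => -(a ε + b ε * Complex.I) / (c ε + d ε * Complex.I)) 0 := by
    refine ContinuousAt.div (f := fun ε => -(a ε + b ε * Complex.I))
      (g := fun ε => c ε + d ε * Complex.I) ?_ ?_ hden
    · exact (by fun_prop : Continuous fun ε => -(a ε + b ε * Complex.I)).continuousAt
    · exact (by fun_prop : Continuous fun ε => (c ε + d ε * Complex.I)).continuousAt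
  have him : 0 < (-(a 0 + b 0 * Complex.I) / (c 0 + d 0 * Complex.I)).im := by
    have hn : 0 < Complex.normSq (c 0 + d 0 * Complex.I) := Complex.normSq_pos.mpr hden
    have : (-(a 0 + b 0 * Complex.I) / (c 0 + d 0 * Complex.I)).im
        = (a0 * d0 - b0 * c0) / Complex.normSq (c 0 + d 0 * Complex.I) := by
      rw [Complex.div_im, ha0, hb0, hc0, hd0]
      simp
      ring
    rw [this]
    exact div_pos (by linarith) hn
  have hcont2 := Complex.continuous_im.continuousAt.comp hcont
  have e1 := hcont2.eventually (lt_mem_nhds him)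
  have e2 : ∀ᶠ ε in nhds (0:ℝ), c ε + d ε * Complex.I ≠ 0 :=
    (by fun_prop : Continuous fun ε => (c ε + d ε * Complex.I)).continuousAt.eventually_ne hden
  have e3 := (e1.and e2).filter_mono (nhdsWithin_le_nhds (s := Set.Ioi (0:ℝ)))
  obtain ⟨ε, ⟨h1, h2⟩, h3⟩ := (e3.and self_mem_nhdsWithin).exists
  refine h ε h3 Complex.I _ (by simp) h1 ?_
  have h4 := div_mul_cancel₀ (-(a ε + b ε * Complex.I)) h2
  linear_combination h4

/-- probability that all coordinates in `T` are one -/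
def prAll {m : ℕ} (π : (Fin m → Bool) → ℝ) (T : Finset (Fin m)) : ℝ :=
  ∑ ξ : Fin m → Bool, if (∀ i ∈ T, ξ i = true) then π ξ else 0

/-- perturbed weight of a coordinate -/
def wt {m : ℕ} (S : Finset (Fin m)) (ε : ℝ) (j : Fin m) (p : Bool) : ℂ :=
  if j ∈ S then (if p then 1 else -(Complex.I * ε)) else (if p then 1 + Complex.I * ε else 1)

/-- coefficient of the bivariate restriction -/
def coefC {m : ℕ} (π : (Fin m → Bool) → ℝ) (S : Finset (Fin m)) (i e : Fin m) (p q : Bool)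
    (ε : ℝ) : ℂ :=
  ∑ ξ : Fin m → Bool, if ξ i = p ∧ ξ e = q then
    (π ξ : ℂ) * ∏ j ∈ (Finset.univ.erase i).erase e, wt S ε j (ξ j) else 0

/-- its limit -/
def coefR {m : ℕ} (π : (Fin m → Bool) → ℝ) (S : Finset (Fin m)) (i e : Fin m) (p q : Bool) : ℝ :=
  ∑ ξ : Fin m → Bool, if ξ i = p ∧ ξ e = q then
    (if (∀ j ∈ S, ξ j = true) then π ξ else 0) else 0

lemma coefC_cont {m : ℕ} (π : (Fin m → Bool) → ℝ) (S : Finset (Fin m)) (i e : Fin m)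
    (p q : Bool) : Continuous (coefC π S i e p q) := by
  unfold coefC
  refine continuous_finsetSum _ fun ξ _ => ?_
  split_ifs
  · refine continuous_const.mul (continuous_finsetProd _ fun j _ => ?_)
    unfold wt
    split_ifs <;> fun_prop
  · exact continuous_const

lemma coefC_zero {m : ℕ} (π : (Fin m → Bool) → ℝ) (S : Finset (Fin m)) (i e : Fin m)
    (hi : i ∉ S) (he : e ∉ S)
    (p q : Bool) : coefC π S i e p q 0 = (coefR π S i e p q : ℂ) := by
  unfold coefC coefR
  push_cast
  refine Finset.sum_congr rfl fun ξ _ => ?_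
  split_ifs with h1 h2
  · rw [Finset.prod_eq_one, mul_one]
    intro j _
    unfold wt
    split_ifs with h3 h4 <;> simp_all
  · push Not at h2
    obtain ⟨j, hj, hj2⟩ := h2
    have : ∏ j ∈ (Finset.univ.erase i).erase e, wt S 0 j (ξ j) = 0 := by
      apply Finset.prod_eq_zero (i := j)
      · simp only [Finset.mem_erase, Finset.mem_univ, and_true]
        exact ⟨fun h => he (h ▸ hj), fun h => hi (h ▸ hj)⟩
      · simp [wt, hj, hj2]
    simp [this]
  · simp

lemma nonvanish {m : ℕ} (π : (Fin m → Bool) → ℝ) (hSR : StronglyRayleigh m π)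
    (S : Finset (Fin m)) (i e : Fin m) (hie : i ≠ e) (ε : ℝ) (hε : 0 < ε) (u v : ℂ)
    (hu : 0 < u.im) (hv : 0 < v.im) :
    coefC π S i e false false ε + coefC π S i e true false ε * u +
      coefC π S i e false true ε * v + coefC π S i e true true ε * (u * v) ≠ 0 := by
  classical
  have hε' : (ε : ℂ) ≠ 0 := by exact_mod_cast hε.ne'
  let z : Fin m → ℂ := fun j => if j = i then u else if j = e then v else
    if j ∈ S then Complex.I * (ε⁻¹ : ℝ) else 1 + Complex.I * ε
  let s : Fin m → ℂ := fun j => if j ∈ S then -(Complex.I * ε) else 1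
  have hz : ∀ j, 0 < (z j).im := by
    intro j
    simp only [z]
    split_ifs
    · exact hu
    · exact hv
    · simpa using hε
    · simpa using hε
  have hs : ∀ j, s j ≠ 0 := by
    intro j
    simp only [s]
    split_ifs <;> simp [hε']
  have key := mul_ne_zero (Finset.prod_ne_zero_iff.mpr
    (fun j (_ : j ∈ (Finset.univ.erase i).erase e) => hs j)) (hSR z hz)
  convert key using 1
  unfold coefC
  rw [Finset.sum_mul, Finset.sum_mul, Finset.sum_mul, Finset.mul_sum, ← Finset.sum_add_distrib,
    ← Finset.sum_add_distrib, ← Finset.sum_add_distrib]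
  refine Finset.sum_congr rfl fun ξ _ => ?_
  have hp : (∏ j ∈ (Finset.univ.erase i).erase e, s j) *
      ∏ j ∈ Finset.univ.filter (fun j => ξ j = true), z j =
      (∏ j ∈ (Finset.univ.erase i).erase e, wt S ε j (ξ j)) *
        ((if ξ i then u else 1) * (if ξ e then v else 1)) := by
    rw [Finset.prod_filter, ← Finset.mul_prod_erase Finset.univ _ (Finset.mem_univ i),
      ← Finset.mul_prod_erase (Finset.univ.erase i) _ (Finset.mem_erase.mpr
        ⟨hie.symm, Finset.mem_univ e⟩)]
    have h2 : ∏ j ∈ (Finset.univ.erase i).erase e, wt S ε j (ξ j) =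
        (∏ j ∈ (Finset.univ.erase i).erase e, s j) *
        ∏ j ∈ (Finset.univ.erase i).erase e, (if ξ j = true then z j else 1) := by
      rw [← Finset.prod_mul_distrib]
      refine Finset.prod_congr rfl fun j hj => ?_
      simp only [Finset.mem_erase, Finset.mem_univ, and_true] at hj
      by_cases hjS : j ∈ S <;> by_cases hx : ξ j = true <;>
        simp [wt, s, z, hj.1, hj.2, hjS, hx]
      have := Complex.I_mul_I
      field_simp
      linear_combination this
    rw [h2]
    have zi : z i = u := by simp [z]
    have ze : z e = v := by simp [z, hie.symm]
    rw [zi, ze]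
    ring
  rw [mul_left_comm (∏ j ∈ (Finset.univ.erase i).erase e, s j), hp]
  cases h1 : ξ i <;> cases h2 : ξ e <;> simp <;> ring

lemma prAll_rayleigh {m : ℕ} (π : (Fin m → Bool) → ℝ) (hSR : StronglyRayleigh m π)
    (S : Finset (Fin m)) (i e : Fin m) (hie : i ≠ e) (hi : i ∉ S) (he : e ∉ S) :
    prAll π (insert e (insert i S)) * prAll π S ≤ prAll π (insert i S) * prAll π (insert e S) := by
  have h := rayleigh_core _ _ _ _ (coefC_cont π S i e false false) (coefC_cont π S i e true false)
    (coefC_cont π S i e false true) (coefC_cont π S i e true true) _ _ _ _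
    (coefC_zero π S i e hi he _ _) (coefC_zero π S i e hi he _ _)
    (coefC_zero π S i e hi he _ _) (coefC_zero π S i e hi he _ _)
    (fun ε hε u v hu hv => nonvanish π hSR S i e hie ε hε u v hu hv)
  have h0 : prAll π S = coefR π S i e false false + coefR π S i e true false +
      coefR π S i e false true + coefR π S i e true true := by
    unfold prAll coefR
    rw [← Finset.sum_add_distrib, ← Finset.sum_add_distrib, ← Finset.sum_add_distrib]
    refine Finset.sum_congr rfl fun ξ _ => ?_
    cases h1 : ξ i <;> cases h2 : ξ e <;> simp
  have h1 : prAll π (insert i S) = coefR π S i e true false + coefR π S i e true true := by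
    unfold prAll coefR
    rw [← Finset.sum_add_distrib]
    refine Finset.sum_congr rfl fun ξ _ => ?_
    cases h1 : ξ i <;> cases h2 : ξ e <;> simp [h1]
  have h2 : prAll π (insert e S) = coefR π S i e false true + coefR π S i e true true := by
    unfold prAll coefR
    rw [← Finset.sum_add_distrib]
    refine Finset.sum_congr rfl fun ξ _ => ?_
    cases h1 : ξ i <;> cases h2 : ξ e <;> simp [h2]
  have h3 : prAll π (insert e (insert i S)) = coefR π S i e true true := by
    unfold prAll coefR
    refine Finset.sum_congr rfl fun ξ _ => ?_
    cases h1 : ξ i <;> cases h2 : ξ e <;> simp [h1, h2]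
  rw [h0, h1, h2, h3]
  nlinarith

lemma prAll_nonneg {m : ℕ} (π : (Fin m → Bool) → ℝ) (hπ0 : ∀ ξ, 0 ≤ π ξ) (T : Finset (Fin m)) :
    0 ≤ prAll π T := by
  unfold prAll
  refine Finset.sum_nonneg fun ξ _ => ?_
  split_ifs
  · exact hπ0 ξ
  · exact le_rfl

lemma prAll_anti {m : ℕ} (π : (Fin m → Bool) → ℝ) (hπ0 : ∀ ξ, 0 ≤ π ξ) {T T' : Finset (Fin m)}
    (h : T ⊆ T') : prAll π T' ≤ prAll π T := by
  unfold prAll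
  refine Finset.sum_le_sum fun ξ _ => ?_
  split_ifs with h1 h2
  · exact le_rfl
  · exact absurd (fun i hi => h1 i (h hi)) h2
  · exact hπ0 ξ
  · exact le_rfl

lemma prAll_neg_dep {m : ℕ} (π : (Fin m → Bool) → ℝ) (hπ0 : ∀ ξ, 0 ≤ π ξ) (hπ1 : ∑ ξ, π ξ = 1)
    (hSR : StronglyRayleigh m π) (e : Fin m) (S : Finset (Fin m)) (he : e ∉ S) :
    prAll π (insert e S) ≤ prAll π S * prAll π {e} := by
  induction S using Finset.induction_on with
  | empty =>
    have : prAll π ∅ = 1 := by simpa [prAll] using hπ1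
    simp [this]
  | insert i S hi ih =>
    have hie : i ≠ e := by rintro rfl; simp at he
    have heS : e ∉ S := fun h => he (Finset.mem_insert_of_mem h)
    have hr := prAll_rayleigh π hSR S i e hie hi heS
    have ih' := ih heS
    have n1 := prAll_nonneg π hπ0 (insert i S)
    rcases (prAll_nonneg π hπ0 S).eq_or_lt with h0 | h0
    · have : prAll π (insert e (insert i S)) ≤ prAll π S := prAll_anti π hπ0
        ((Finset.subset_insert _ _).trans (Finset.subset_insert _ _))
      have := mul_nonneg n1 (prAll_nonneg π hπ0 {e})
      linarith
    · refine le_of_mul_le_mul_right ?_ h0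
      have := mul_le_mul_of_nonneg_left ih' n1
      linarith

/-- conditional version of the expected-matrix bound for k-homogeneous
Strongly Rayleigh distributions. -/
theorem conditional_matrix_mean_bound {m n k : ℕ}
    (π : (Fin m → Bool) → ℝ) (hπ0 : ∀ ξ, 0 ≤ π ξ) (hπ1 : ∑ ξ, π ξ = 1)
    (hhom : kHomogeneous m k π) (hSR : StronglyRayleigh m π)
    (Y : Fin m → Matrix (Fin n) (Fin n) ℝ) (hY : ∀ e, (Y e).PosSemidef)
    (μ : ℝ) (hμ0 : 0 ≤ μ)
    (hmean : (μ • (1 : Matrix (Fin n) (Fin n) ℝ) -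
      ∑ e : Fin m,
        (∑ ξ ∈ Finset.univ.filter (fun ξ : Fin m → Bool => ξ e = true), π ξ) • Y e).PosSemidef)
    (S : Finset (Fin m)) (hS : S.card ≤ k - 1)
    (hpos : 0 < ∑ ξ ∈ Finset.univ.filter (fun ξ : Fin m → Bool => ∀ i ∈ S, ξ i = true), π ξ) :
    (μ • (1 : Matrix (Fin n) (Fin n) ℝ) -
      ∑ e ∈ Finset.univ \ S,
        ((∑ ξ ∈ Finset.univ.filter
            (fun ξ : Fin m → Bool => ξ e = true ∧ ∀ i ∈ S, ξ i = true), π ξ) /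
          (∑ ξ ∈ Finset.univ.filter (fun ξ : Fin m → Bool => ∀ i ∈ S, ξ i = true), π ξ))
          • Y e).PosSemidef := by
  have hp : ∀ e : Fin m, (∑ ξ ∈ Finset.univ.filter (fun ξ : Fin m → Bool => ξ e = true), π ξ)
      = prAll π {e} := by
    intro e
    simp [prAll, Finset.sum_filter]
  have hq : (∑ ξ ∈ Finset.univ.filter (fun ξ : Fin m → Bool => ∀ i ∈ S, ξ i = true), π ξ)
      = prAll π S := by
    rw [prAll, Finset.sum_filter]
  have hr : ∀ e : Fin m, (∑ ξ ∈ Finset.univ.filter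
      (fun ξ : Fin m → Bool => ξ e = true ∧ ∀ i ∈ S, ξ i = true), π ξ)
      = prAll π (insert e S) := by
    intro e
    simp [prAll, Finset.sum_filter]
  simp only [hp] at hmean
  rw [hq] at hpos
  simp only [hq, hr]
  have hsplit : (∑ e : Fin m, prAll π {e} • Y e) =
      ∑ e ∈ Finset.univ \ S, prAll π {e} • Y e + ∑ e ∈ S, prAll π {e} • Y e :=
    (Finset.sum_sdiff (Finset.subset_univ S)).symm
  have hA : (∑ e ∈ Finset.univ \ S,
      (prAll π {e} - prAll π (insert e S) / prAll π S) • Y e).PosSemidef := by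
    refine Matrix.posSemidef_sum _ fun e he => (hY e).smul ?_
    have heS : e ∉ S := (Finset.mem_sdiff.mp he).2
    have := prAll_neg_dep π hπ0 hπ1 hSR e S heS
    rw [sub_nonneg, div_le_iff₀ hpos]
    linarith
  have hB : (∑ e ∈ S, prAll π {e} • Y e).PosSemidef :=
    Matrix.posSemidef_sum _ fun e _ => (hY e).smul (prAll_nonneg π hπ0 _)
  convert (hmean.add hA).add hB using 1
  rw [hsplit]
  simp only [sub_smul, Finset.sum_sub_distrib]
  abel
end
end

section
/- Let n ≥ 4 and let d be an integer with 1 ≤ d ≤ n − 2. If T is a uniform random spanning tree of the complete graph K_n, then the probability that at least one vertex of T has degree at least d is at least 2^{−d·log d − 3}, where log denotes the base-2 logarithm (and d·log d = 0 when d = 1). -/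
open Matrix Finset
attribute [local instance] Classical.propDecidable

noncomputable section

/-- Degree of `v` in the edge set `T`. -/
def degIn (n : ℕ) (v : Fin n) (T : Finset (Sym2 (Fin n))) : ℕ :=
  (T.filter (fun e => v ∈ e)).card

lemma reach_del {n : ℕ} (S : Set (Sym2 (Fin n))) (a b : Fin n) {w c : Fin n}
    (p : (SimpleGraph.fromEdgeSet S).Walk w c) (hc : c = a) :
    (SimpleGraph.fromEdgeSet (S \ {s(a, b)})).Reachable w a ∨
      (SimpleGraph.fromEdgeSet (S \ {s(a, b)})).Reachable w b := by
  induction p with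
  | nil => subst hc; exact Or.inl (SimpleGraph.Reachable.refl _)
  | @cons u v' w' h p ih =>
    by_cases he : s(u, v') = s(a, b)
    · rcases Sym2.eq_iff.1 he with ⟨rfl, _⟩ | ⟨rfl, _⟩
      · exact Or.inl (SimpleGraph.Reachable.refl _)
      · exact Or.inr (SimpleGraph.Reachable.refl _)
    · have hadj : (SimpleGraph.fromEdgeSet (S \ {s(a, b)})).Adj u v' := by
        rw [SimpleGraph.fromEdgeSet_adj] at h ⊢
        exact ⟨⟨h.1, he⟩, h.2⟩
      exact (ih hc).imp hadj.reachable.trans hadj.reachable.trans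

lemma conn_card {n : ℕ} (T : Finset (Sym2 (Fin n)))
    (h : (SimpleGraph.fromEdgeSet (↑T : Set (Sym2 (Fin n)))).Connected) :
    n ≤ T.card + 1 := by
  have h1 := h.card_vert_le_card_edgeSet_add_one
  have h2 : Nat.card (SimpleGraph.fromEdgeSet (↑T : Set (Sym2 (Fin n)))).edgeSet ≤ T.card := by
    rw [SimpleGraph.edgeSet_fromEdgeSet, Nat.card_coe_set_eq]
    calc _ ≤ (↑T : Set (Sym2 (Fin n))).ncard := Set.ncard_le_ncard Set.sdiff_subset
      _ = T.card := Set.ncard_coe_finset T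
  simp only [Nat.card_eq_fintype_card, Fintype.card_fin] at h1 h2
  omega

lemma move_aux {n : ℕ} {T : Finset (Sym2 (Fin n))} (hT : IsSpanningTree n ⊤ T) (v a b : Fin n)
    (he : s(a, b) ∈ T) (hv : v ∉ s(a, b))
    (hr : (SimpleGraph.fromEdgeSet ((↑T : Set (Sym2 (Fin n))) \ {s(a, b)})).Reachable v a) :
    s(v, b) ∉ T ∧ IsSpanningTree n ⊤ (insert s(v, b) (T.erase s(a, b))) := by
  obtain ⟨h1, h2, h3⟩ := hT
  have hva : v ≠ a := by rintro rfl; simp at hv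
  have hvb : v ≠ b := by rintro rfl; simp at hv
  set G' := SimpleGraph.fromEdgeSet ((↑T : Set (Sym2 (Fin n))) \ {s(a, b)}) with hG'
  have hall : ∀ w, G'.Reachable w a ∨ G'.Reachable w b := fun w =>
    reach_del _ a b (h2.preconnected w a).some rfl
  have hn0 : 0 < T.card := Finset.card_pos.2 ⟨_, he⟩
  have hnot : s(v, b) ∉ T := by
    intro hvT
    have hadj : G'.Adj v b := by
      rw [hG', SimpleGraph.fromEdgeSet_adj]
      refine ⟨⟨hvT, ?_⟩, hvb⟩
      intro h
      have h : s(v, b) = s(a, b) := h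
      exact hv (h ▸ Sym2.mem_mk_left v b)
    have hav : ∀ w, G'.Reachable w a := fun w =>
      (hall w).elim id (fun h => h.trans (hadj.symm.reachable.trans hr))
    have hc : (SimpleGraph.fromEdgeSet (↑(T.erase s(a, b)) : Set (Sym2 (Fin n)))).Connected := by
      rw [Finset.coe_erase]
      have : Nonempty (Fin n) := ⟨v⟩
      exact ⟨fun x y => (hav x).trans (hav y).symm⟩
    have := conn_card _ hc
    rw [Finset.card_erase_of_mem he] at this
    omega
  refine ⟨hnot, ?_, ?_, ?_⟩
  · intro e hh
    rw [Finset.mem_coe, Finset.mem_insert, Finset.mem_erase] at hh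
    rcases hh with rfl | hh
    · simpa using hvb
    · exact h1 hh.2
  · have : Nonempty (Fin n) := ⟨v⟩
    set G'' := SimpleGraph.fromEdgeSet
      (↑(insert s(v, b) (T.erase s(a, b))) : Set (Sym2 (Fin n))) with hG''
    have hle : G' ≤ G'' := by
      apply SimpleGraph.fromEdgeSet_mono
      intro e hh
      have h4 : e ∈ T := hh.1
      have h5 : e ≠ s(a, b) := hh.2
      simp [h4, h5]
    have hadj : G''.Adj v b := by
      rw [hG'', SimpleGraph.fromEdgeSet_adj]
      exact ⟨by simp, hvb⟩
    have hw : ∀ w, G''.Reachable w v := fun w =>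
      (hall w).elim (fun h => (h.mono hle).trans (hr.mono hle).symm)
        (fun h => (h.mono hle).trans hadj.symm.reachable)
    exact ⟨fun x y => (hw x).trans (hw y).symm⟩
  · rw [Finset.card_insert_of_notMem (by simp [hnot]), Finset.card_erase_of_mem he]
    omega

lemma move_exists {n : ℕ} {T : Finset (Sym2 (Fin n))} (hT : IsSpanningTree n ⊤ T) (v : Fin n)
    (e : Sym2 (Fin n)) (he : e ∈ T) (hv : v ∉ e) :
    ∃ q : Fin n × Fin n, e = s(q.2, q.1) ∧ s(v, q.1) ∉ T ∧
      IsSpanningTree n ⊤ (insert s(v, q.1) (T.erase e)) := by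
  induction e using Sym2.ind with
  | _ a b =>
    rcases reach_del _ a b (hT.2.1.preconnected v a).some rfl with h | h
    · exact ⟨(b, a), rfl, move_aux hT v a b he hv h⟩
    · have hs : s(a, b) = s(b, a) := Sym2.eq_swap
      rw [hs] at he hv h ⊢
      exact ⟨(a, b), rfl, move_aux hT v b a he hv h⟩

/-- Trees with degree exactly `k` at `v`. -/
def treesEq (n : ℕ) (v : Fin n) (k : ℕ) : Finset (Finset (Sym2 (Fin n))) :=
  Finset.univ.filter (fun T => IsSpanningTree n ⊤ T ∧ degIn n v T = k)

/-- Trees with degree at least `k` at `v`. -/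
def treesGe (n : ℕ) (v : Fin n) (k : ℕ) : Finset (Finset (Sym2 (Fin n))) :=
  Finset.univ.filter (fun T => IsSpanningTree n ⊤ T ∧ k ≤ degIn n v T)

lemma treesGe_split (n : ℕ) (v : Fin n) (k : ℕ) :
    (treesGe n v k).card = (treesEq n v k).card + (treesGe n v (k + 1)).card := by
  rw [← Finset.card_union_of_disjoint]
  · congr 1
    ext T
    simp only [treesGe, treesEq, Finset.mem_union, Finset.mem_filter, Finset.mem_univ, true_and]
    constructor
    · rintro ⟨h, h'⟩
      rcases Nat.eq_or_lt_of_le h' with h1 | h1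
      · exact Or.inl ⟨h, h1.symm⟩
      · exact Or.inr ⟨h, h1⟩
    · rintro (⟨h, h'⟩ | ⟨h, h'⟩)
      · exact ⟨h, h'.ge⟩
      · exact ⟨h, by omega⟩
  · rw [Finset.disjoint_left]
    intro T h1 h2
    simp only [treesGe, treesEq, Finset.mem_filter, Finset.mem_univ, true_and] at h1 h2
    omega

lemma deg_move {n : ℕ} {T : Finset (Sym2 (Fin n))} (v x : Fin n) (e : Sym2 (Fin n))
    (hv : v ∉ e) (hx : s(v, x) ∉ T) :
    degIn n v (insert s(v, x) (T.erase e)) = degIn n v T + 1 := by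
  unfold degIn
  rw [Finset.filter_insert, if_pos (Sym2.mem_mk_left v x),
    Finset.card_insert_of_notMem (by simp [hx])]
  congr 2
  ext f
  simp only [Finset.mem_filter, Finset.mem_erase]
  constructor
  · rintro ⟨⟨_, h⟩, h'⟩; exact ⟨h, h'⟩
  · rintro ⟨h, h'⟩
    exact ⟨⟨by rintro rfl; exact hv h', h⟩, h'⟩

lemma step_count (n : ℕ) (v : Fin n) (k : ℕ) (hn : 2 ≤ n) :
    (treesEq n v k).card * (n - 1 - k) ≤
      (treesEq n v (k + 1)).card * ((k + 1) * (n - 2)) := by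
  classical
  let A : Finset (Σ _ : Finset (Sym2 (Fin n)), Sym2 (Fin n)) :=
    (treesEq n v k).sigma (fun T => T.filter (fun e => ¬ v ∈ e))
  let B : Finset (Σ _ : Finset (Sym2 (Fin n)), Sym2 (Fin n) × Fin n) :=
    (treesEq n v (k + 1)).sigma
      (fun T => (T.filter (fun e => v ∈ e)).biUnion
        (fun e => ((Finset.univ.filter (fun y => y ∉ e)).image (fun y => (e, y)))))
  have hA : A.card = (treesEq n v k).card * (n - 1 - k) := by
    rw [Finset.card_sigma, Finset.sum_const_nat]
    intro T hT
    simp only [treesEq, Finset.mem_filter, Finset.mem_univ, true_and] at hT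
    have := Finset.card_filter_add_card_filter_not (s := T) (fun e => v ∈ e)
    have h2 := hT.2
    unfold degIn at h2
    have h3 := hT.1.2.2
    omega
  have hB : B.card ≤ (treesEq n v (k + 1)).card * ((k + 1) * (n - 2)) := by
    rw [Finset.card_sigma]
    refine (Finset.sum_le_card_nsmul _ _ ((k + 1) * (n - 2)) ?_)
    intro T hT
    simp only [treesEq, Finset.mem_filter, Finset.mem_univ, true_and] at hT
    have h2 := hT.2
    unfold degIn at h2
    rw [← h2]
    apply Finset.card_biUnion_le_card_mul
    intro e he
    refine Finset.card_image_le.trans ?_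
    have heT := hT.1.1 (Finset.mem_filter.1 he).1
    induction e using Sym2.ind with
    | _ a b =>
      have hab : a ≠ b := by simpa using heT
      have : (Finset.univ.filter (fun y => y ∉ s(a, b))) = ({a, b} : Finset (Fin n))ᶜ := by
        ext y; simp
      rw [this, Finset.card_compl, Finset.card_pair hab, Fintype.card_fin]
  rw [← hA]
  refine le_trans ?_ hB
  have hex : ∀ p : (Σ _ : Finset (Sym2 (Fin n)), Sym2 (Fin n)), ∃ q : Fin n × Fin n, p ∈ A →
      p.2 = s(q.2, q.1) ∧ s(v, q.1) ∉ p.1 ∧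
      IsSpanningTree n ⊤ (insert s(v, q.1) (p.1.erase p.2)) := by
    intro p
    by_cases hp : p ∈ A
    · have h := Finset.mem_sigma.1 hp
      simp only [treesEq, Finset.mem_filter, Finset.mem_univ, true_and] at h
      obtain ⟨q, hq⟩ := move_exists h.1.1 v p.2 h.2.1 h.2.2
      exact ⟨q, fun _ => hq⟩
    · exact ⟨(v, v), fun h => absurd h hp⟩
  choose q hq using hex
  refine Finset.card_le_card_of_injOn
    (fun p => ⟨insert s(v, (q p).1) (p.1.erase p.2), (s(v, (q p).1), (q p).2)⟩) ?_ ?_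
  · intro p hp
    have hp : p ∈ A := hp
    obtain ⟨h1, h2, h3⟩ := hq p hp
    have h := Finset.mem_sigma.1 hp
    simp only [treesEq, Finset.mem_filter, Finset.mem_univ, true_and] at h
    have hne : (q p).2 ≠ (q p).1 := by
      have := h.1.1.1 h.2.1
      rw [h1] at this
      simpa using this
    have hve : v ∉ s((q p).2, (q p).1) := h1 ▸ h.2.2
    simp only [Sym2.mem_iff, not_or] at hve
    refine Finset.mem_coe.2 (Finset.mem_sigma.2 ⟨?_, ?_⟩)
    · simp only [treesEq, Finset.mem_filter, Finset.mem_univ, true_and]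
      exact ⟨h3, by rw [deg_move v _ _ h.2.2 h2, h.1.2]⟩
    · simp only [Finset.mem_biUnion, Finset.mem_filter, Finset.mem_image, Finset.mem_univ,
        true_and]
      refine ⟨s(v, (q p).1), ⟨by simp, by simp⟩, (q p).2, ?_, rfl⟩
      simp only [Sym2.mem_iff, not_or]
      exact ⟨fun h => hve.1 h.symm, hne⟩
  · intro p hp p' hp' heq
    have hp : p ∈ A := hp
    have hp' : p' ∈ A := hp'
    obtain ⟨h1, h2, -⟩ := hq p hp
    obtain ⟨h1', h2', -⟩ := hq p' hp'
    have h := (Finset.mem_sigma.1 hp).2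
    have h' := (Finset.mem_sigma.1 hp').2
    simp only [Finset.mem_filter] at h h'
    simp only [Sigma.mk.injEq, heq_eq_eq, Prod.mk.injEq] at heq
    obtain ⟨ha, hb, hc⟩ := heq
    have hx : (q p).1 = (q p').1 := by
      rcases Sym2.eq_iff.1 hb with h | h
      · exact h.2
      · exact h.2.trans h.1
    have he : p.2 = p'.2 := by rw [h1, h1', hx, hc]
    have rec1 : ∀ (T : Finset (Sym2 (Fin n))) (e f : Sym2 (Fin n)), e ∈ T → f ∉ T →
        insert e ((insert f (T.erase e)).erase f) = T := by
      intro T e f he hf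
      rw [Finset.erase_insert (by simp [hf]), Finset.insert_erase he]
    have hT : p.1 = p'.1 := by
      rw [← rec1 p.1 p.2 _ h.1 h2, ha, hb, he, rec1 p'.1 p'.2 _ h'.1 h2']
    exact Sigma.ext hT (heq_of_eq he)

lemma step_ge (n : ℕ) (v : Fin n) (d k : ℕ) (hd : d ≤ n - 2) (hn : 2 ≤ n) (hk : 1 ≤ k)
    (hkd : k ≤ d) :
    (treesGe n v k).card * (d + 1 - k) ≤ (treesGe n v (k + 1)).card * ((k + 2) * d) := by
  have h1 := step_count n v k hn
  have h2 := treesGe_split n v k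
  have h3 := treesGe_split n v (k + 1)
  obtain ⟨m, rfl⟩ : ∃ m, n = m + 2 := ⟨n - 2, by omega⟩
  obtain ⟨j, rfl⟩ : ∃ j, d = k + j := ⟨d - k, by omega⟩
  obtain ⟨i, rfl⟩ : ∃ i, m = k + j + i := ⟨m - (k + j), by omega⟩
  generalize (treesGe _ v k).card = Mk at *
  generalize (treesGe _ v (k + 1)).card = Mk1 at *
  generalize (treesEq _ v k).card = Nk at *
  generalize (treesEq _ v (k + 1)).card = Nk1 at *
  have e1 : k + j + i + 2 - 1 - k = j + i + 1 := by omega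
  have e2 : k + j + i + 2 - 2 = k + j + i := by omega
  have e3 : k + j + 1 - k = j + 1 := by omega
  rw [e1, e2] at h1
  rw [e3]
  have hN : Nk1 ≤ Mk1 := by omega
  have h4 : Nk * (j + 1) ≤ Mk1 * ((k + 1) * (k + j)) := by
    have h5 : Nk * (j + i + 1) ≤ Mk1 * ((k + 1) * (k + j + i)) :=
      h1.trans (Nat.mul_le_mul_right _ hN)
    have h6 : (k + j + i) * (j + 1) ≤ (k + j) * (j + i + 1) := by nlinarith [Nat.zero_le (k*i), Nat.zero_le (j * i), Nat.mul_le_mul_right i hk]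
    have h7 : (Nk * (j + 1)) * (j + i + 1) ≤ (Mk1 * ((k + 1) * (k + j))) * (j + i + 1) := by
      calc (Nk * (j + 1)) * (j + i + 1) = (Nk * (j + i + 1)) * (j + 1) := by ring
        _ ≤ (Mk1 * ((k + 1) * (k + j + i))) * (j + 1) := Nat.mul_le_mul_right _ h5
        _ = (Mk1 * (k + 1)) * ((k + j + i) * (j + 1)) := by ring
        _ ≤ (Mk1 * (k + 1)) * ((k + j) * (j + i + 1)) := Nat.mul_le_mul_left _ h6
        _ = _ := by ring
    exact Nat.le_of_mul_le_mul_right h7 (by omega)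
  have h8 : Mk1 * (j + 1) ≤ Mk1 * (k + j) := Nat.mul_le_mul_left _ (by omega)
  rw [h2]
  nlinarith

lemma chain (n : ℕ) (v : Fin n) (d : ℕ) (hd : d ≤ n - 2) (hn : 2 ≤ n) (k : ℕ) (hk : k + 1 ≤ d) :
    2 * (treesGe n v 1).card * d.descFactorial k ≤
      (treesGe n v (k + 1)).card * (d ^ k * (k + 2).factorial) := by
  induction k with
  | zero => simp; omega
  | succ k ih =>
    have h1 := ih (by omega)
    have h2 := step_ge n v d (k + 1) hd hn (by omega) (by omega)
    have e : d + 1 - (k + 1) = d - k := by omega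
    rw [e] at h2
    rw [Nat.descFactorial_succ, Nat.factorial_succ (k + 2), pow_succ]
    calc _ = (2 * (treesGe n v 1).card * d.descFactorial k) * (d - k) := by ring
      _ ≤ ((treesGe n v (k + 1)).card * (d ^ k * (k + 2).factorial)) * (d - k) :=
        Nat.mul_le_mul_right _ h1
      _ = ((treesGe n v (k + 1)).card * (d - k)) * (d ^ k * (k + 2).factorial) := by ring
      _ ≤ ((treesGe n v (k + 1 + 1)).card * ((k + 1 + 2) * d)) * (d ^ k * (k + 2).factorial) :=
        Nat.mul_le_mul_right _ h2
      _ = _ := by ring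

lemma main_count (n : ℕ) (v : Fin n) (d : ℕ) (hd : d ≤ n - 2) (hn : 2 ≤ n) (hd1 : 1 ≤ d) :
    (treesGe n v 1).card ≤ (treesGe n v d).card * d ^ d := by
  obtain ⟨k, rfl⟩ : ∃ k, d = k + 1 := ⟨d - 1, by omega⟩
  have h := chain n v (k + 1) hd hn k le_rfl
  have e : (k + 1).descFactorial k = (k + 1).factorial := by
    have := Nat.descFactorial_self (k + 1)
    rw [Nat.descFactorial_succ] at this
    simpa using this
  rw [e, Nat.factorial_succ (k + 1)] at h
  have h2 : 2 * (treesGe n v 1).card ≤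
      (treesGe n v (k + 1)).card * ((k + 1) ^ k * (k + 2)) := by
    apply Nat.le_of_mul_le_mul_right _ (Nat.factorial_pos (k + 1))
    calc _ ≤ _ := h
      _ = _ := by ring
  have h3 : (treesGe n v (k + 1)).card * ((k + 1) ^ k * (k + 2)) ≤
      2 * ((treesGe n v (k + 1)).card * (k + 1) ^ (k + 1)) := by
    calc _ ≤ (treesGe n v (k + 1)).card * ((k + 1) ^ k * (2 * (k + 1))) := by
          gcongr; omega
      _ = _ := by ring
  omega

lemma treesGe_one (n : ℕ) (v : Fin n) (hn : 2 ≤ n) :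
    treesGe n v 1 = Finset.univ.filter (fun T => IsSpanningTree n ⊤ T) := by
  ext T
  simp only [treesGe, Finset.mem_filter, Finset.mem_univ, true_and, and_iff_left_iff_imp]
  intro hT
  have : Nontrivial (Fin n) := Fin.nontrivial_iff_two_le.2 hn
  obtain ⟨u, hu⟩ := hT.2.1.preconnected.exists_adj_of_nontrivial v
  rw [SimpleGraph.fromEdgeSet_adj] at hu
  exact Finset.card_pos.2 ⟨s(v, u), Finset.mem_filter.2 ⟨hu.1, by simp⟩⟩

lemma exists_tree (n : ℕ) (hn : 2 ≤ n) :
    0 < (Finset.univ.filter (fun T => IsSpanningTree n ⊤ T)).card := by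
  have : Nonempty (Fin n) := ⟨⟨0, by omega⟩⟩
  obtain ⟨G, -, hG⟩ := (SimpleGraph.connected_top (V := Fin n)).exists_isTree_le
  refine Finset.card_pos.2 ⟨G.edgeFinset, Finset.mem_filter.2 ⟨Finset.mem_univ _, ?_, ?_, ?_⟩⟩
  · rw [SimpleGraph.coe_edgeFinset]
    exact SimpleGraph.edgeSet_mono le_top
  · rw [SimpleGraph.coe_edgeFinset, SimpleGraph.fromEdgeSet_edgeSet]
    exact hG.connected
  · have := hG.card_edgeFinset
    rw [Fintype.card_fin] at this
    omega

/-- a uniform random spanning tree of K_n has a vertex of degree at least d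
with probability at least 2^{-d log d - 3}. -/
theorem high_degree_vertex_probability (n d : ℕ) (hn : 4 ≤ n) (hd1 : 1 ≤ d)
    (hd2 : d ≤ n - 2) :
    (2 : ℝ) ^ (-((d : ℝ) * Real.logb 2 d) - 3) ≤
      ∑ T ∈ Finset.univ.filter (fun T : Finset (Sym2 (Fin n)) =>
        ∃ v : Fin n, d ≤ (T.filter (fun e => v ∈ e)).card),
        treeProb n (⊤ : SimpleGraph (Fin n)) 1 T := by
  have hd0 : (0 : ℝ) < d := by exact_mod_cast hd1
  let v : Fin n := ⟨0, by omega⟩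
  have hpow : (2 : ℝ) ^ (-((d : ℝ) * Real.logb 2 d) - 3) ≤ 1 / (d : ℝ) ^ d := by
    calc (2 : ℝ) ^ (-((d : ℝ) * Real.logb 2 d) - 3)
        ≤ (2 : ℝ) ^ (-((d : ℝ) * Real.logb 2 d)) :=
          Real.rpow_le_rpow_of_exponent_le (by norm_num) (by linarith)
      _ = 1 / (d : ℝ) ^ d := by
          rw [Real.rpow_neg (by norm_num), mul_comm, Real.rpow_mul (by norm_num),
            Real.rpow_logb (by norm_num) (by norm_num) hd0, Real.rpow_natCast, one_div]
  have hc := main_count n v d hd2 (by omega) hd1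
  rw [treesGe_one n v (by omega)] at hc
  have hpos := exists_tree n (by omega)
  set N := (Finset.univ.filter (fun T => IsSpanningTree n ⊤ T)).card with hN
  have hprob : ∀ T, treeProb n ⊤ 1 T = (if IsSpanningTree n ⊤ T then 1 else 0) / (N : ℝ) := by
    intro T
    simp [treeProb, treeWt, hN]
  have hNR : (0 : ℝ) < N := by exact_mod_cast hpos
  have hsum : ((treesGe n v d).card : ℝ) / N ≤
      ∑ T ∈ Finset.univ.filter (fun T : Finset (Sym2 (Fin n)) =>
        ∃ v : Fin n, d ≤ (T.filter (fun e => v ∈ e)).card),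
        treeProb n (⊤ : SimpleGraph (Fin n)) 1 T := by
    calc ((treesGe n v d).card : ℝ) / N
        = ∑ T ∈ treesGe n v d, treeProb n (⊤ : SimpleGraph (Fin n)) 1 T := by
          rw [Finset.sum_congr rfl (g := fun _ => 1 / (N : ℝ))]
          · rw [Finset.sum_const, nsmul_eq_mul]; ring
          · intro T hT
            rw [hprob, if_pos (Finset.mem_filter.1 hT).2.1]
      _ ≤ _ := by
          apply Finset.sum_le_sum_of_subset_of_nonneg
          · intro T hT
            exact Finset.mem_filter.2 ⟨Finset.mem_univ _, v, (Finset.mem_filter.1 hT).2.2⟩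
          · intro T _ _
            rw [hprob]
            split_ifs <;> positivity
  refine hpow.trans (le_trans ?_ hsum)
  rw [div_le_div_iff₀ (by positivity) hNR, one_mul]
  exact_mod_cast hc

end
end

section
/- Let n ≥ 2 and let T be a spanning tree of the complete unweighted graph K_n that contains a vertex of degree at least d, where d ≥ 1 is an integer. Let L_T = Σ_{e∈T} (n/2)·b_e b_eᵀ be the inverse-leverage-score-weighted Laplacian of T (every edge of K_n has leverage score 2/n), and let L_G be the Laplacian of K_n. Then L_T ⋠ (d/2)·L_G, i.e. the matrix (d/2)·L_G − L_T is not positive semidefinite. -/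
open Matrix Finset
attribute [local instance] Classical.propDecidable

noncomputable section

/-- a spanning tree of K_n with a vertex of degree at least d satisfies
L_T ⋠ (d/2) L_G. -/
theorem high_degree_tree_not_dominated (n d : ℕ) (hn : 2 ≤ n) (hd : 1 ≤ d)
    (T : Finset (Sym2 (Fin n))) (hT : IsSpanningTree n (⊤ : SimpleGraph (Fin n)) T)
    (v : Fin n) (hv : d ≤ (T.filter (fun e => v ∈ e)).card) :
    ¬ (((d : ℝ) / 2) • lap n (⊤ : SimpleGraph (Fin n)) 1
        - ∑ e ∈ T, ((n : ℝ) / 2) • edgeMat n e).PosSemidef := by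
  intro h
  have h0 := h.diag_nonneg (i := v)
  have hdiag : ∀ e : Sym2 (Fin n), edgeMat n e v v = if v ∈ e then 1 else 0 := by
    intro e
    simp [edgeMat]
  have hlap : lap n (⊤ : SimpleGraph (Fin n)) 1 v v ≤ (n : ℝ) - 1 := by
    have h1 : lap n (⊤ : SimpleGraph (Fin n)) 1 v v =
        ((Finset.univ.filter (fun e : Sym2 (Fin n) =>
          e ∈ (⊤ : SimpleGraph (Fin n)).edgeSet ∧ v ∈ e)).card : ℝ) := by
      rw [Finset.card_filter]
      push_cast
      unfold lap
      rw [Matrix.sum_apply]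
      refine Finset.sum_congr rfl fun e _ => ?_
      rw [Matrix.smul_apply, hdiag]
      by_cases h1 : e ∈ (⊤ : SimpleGraph (Fin n)).edgeSet <;> by_cases h2 : v ∈ e <;>
        simp only [h1, h2] <;> simp
    have h2 : (Finset.univ.filter (fun e : Sym2 (Fin n) =>
          e ∈ (⊤ : SimpleGraph (Fin n)).edgeSet ∧ v ∈ e)).card ≤ n - 1 := by
      have hsub : (Finset.univ.filter (fun e : Sym2 (Fin n) =>
          e ∈ (⊤ : SimpleGraph (Fin n)).edgeSet ∧ v ∈ e)) ⊆
          (Finset.univ.erase v).image (fun u => s(v, u)) := by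
        intro e he
        obtain ⟨he1, he2⟩ := (Finset.mem_filter.mp he).2
        obtain ⟨u, rfl⟩ := Sym2.mem_iff_exists.mp he2
        have hne : v ≠ u := by
          have := (SimpleGraph.mem_edgeSet _).mp he1
          exact this.ne
        exact Finset.mem_image.mpr
          ⟨u, Finset.mem_erase.mpr ⟨hne.symm, Finset.mem_univ _⟩, rfl⟩
      refine (Finset.card_le_card hsub).trans (Finset.card_image_le.trans ?_)
      rw [Finset.card_erase_of_mem (Finset.mem_univ _)]
      simp
    rw [h1]
    have h3 : ((n - 1 : ℕ) : ℝ) = (n : ℝ) - 1 := by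
      rw [Nat.cast_sub (by omega)]
      simp
    rw [← h3]
    exact_mod_cast h2
  have htree : (∑ e ∈ T, ((n : ℝ) / 2) • edgeMat n e) v v =
      (n : ℝ) / 2 * ((T.filter (fun e => v ∈ e)).card : ℝ) := by
    rw [Matrix.sum_apply, Finset.card_filter]
    push_cast
    rw [Finset.mul_sum]
    refine Finset.sum_congr rfl fun e _ => ?_
    rw [Matrix.smul_apply, hdiag, smul_eq_mul]
  rw [Matrix.sub_apply, Matrix.smul_apply, htree, smul_eq_mul] at h0
  have hv' : (d : ℝ) ≤ ((T.filter (fun e => v ∈ e)).card : ℝ) := by exact_mod_cast hv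
  have hd' : (1 : ℝ) ≤ d := by exact_mod_cast hd
  have hn' : (2 : ℝ) ≤ n := by exact_mod_cast hn
  have a1 := mul_le_mul_of_nonneg_left hlap (by positivity : (0 : ℝ) ≤ (d : ℝ) / 2)
  have a2 := mul_le_mul_of_nonneg_left hv' (by positivity : (0 : ℝ) ≤ (n : ℝ) / 2)
  nlinarith

end
end

section
/- Let k ≥ 1 be an integer, p ∈ (0, 1/2], and ε ∈ (0, 1/2], and assume ε²·p·k ≥ 3. Let X be the average of k independent Bernoulli random variables each with mean p (so k·X has the Binomial(k, p) distribution). Then Pr[ X ≤ (1−ε)·p ] ≥ exp(−9·ε²·p·k) and Pr[ X ≥ (1+ε)·p ] ≥ exp(−9·ε²·p·k). -/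
open Matrix Finset
attribute [local instance] Classical.propDecidable

noncomputable section

theorem rc_sum_prod (k : ℕ) (x y : ℝ) :
    ∑ b : Fin k → Bool, ∏ i, (if b i then x else y) = (x + y) ^ k := by
  have h := Fintype.sum_pow (fun c : Bool => if c then x else y) k
  rw [← h]
  simp

theorem rc_exp_card (k : ℕ) (m : ℝ) (b : Fin k → Bool) :
    Real.exp (m * ((Finset.univ.filter fun i => b i = true).card : ℝ)) =
      ∏ i, (if b i then Real.exp m else 1) := by
  rw [Finset.prod_ite]
  simp only [Finset.prod_const, one_pow, mul_one]
  rw [mul_comm, Real.exp_nat_mul]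

theorem rc_main (k : ℕ) (p ε σ : ℝ) (hσ : σ = 1 ∨ σ = -1)
    (hp1 : 0 < p) (hp2 : p ≤ 1 / 2) (hε1 : 0 < ε) (hε2 : ε ≤ 1 / 2)
    (h : 3 ≤ ε ^ 2 * p * k) (A : (Fin k → Bool) → Prop)
    (hA : ∀ b, ¬ A b →
      σ * (((Finset.univ.filter fun i => b i = true).card : ℝ) - (1 + σ * ε) * p * k) ≤ 0) :
    Real.exp (-(9 * ε ^ 2 * p * k)) ≤
      ∑ b ∈ Finset.univ.filter A, ∏ i, (if b i then p else 1 - p) := by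
  have hs2 : σ ^ 2 = 1 := by rcases hσ with rfl | rfl <;> norm_num
  have hk0 : (0 : ℝ) ≤ k := Nat.cast_nonneg k
  obtain ⟨q, hq⟩ : ∃ q, q = (1 + 2 * σ * ε) * p := ⟨_, rfl⟩
  have hq0 : 0 ≤ q := by
    rw [hq]; apply mul_nonneg _ hp1.le
    rcases hσ with rfl | rfl <;> linarith
  have hq2 : q ≤ 2 * p := by
    rw [hq]; apply mul_le_mul_of_nonneg_right _ hp1.le
    rcases hσ with rfl | rfl <;> linarith
  have hq1 : 0 ≤ 1 - q := by linarith
  have hp3 : 0 < 1 - p := by linarith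
  obtain ⟨m, hm⟩ : ∃ m, m = -(σ * ε / 4) := ⟨_, rfl⟩
  have hW : ∀ b : Fin k → Bool, 0 ≤ ∏ i, (if b i then q else 1 - q) := fun b =>
    Finset.prod_nonneg fun i _ => by split_ifs <;> assumption
  -- tail of the tilted measure
  have htail : ∑ b ∈ Finset.univ.filter (fun b => ¬ A b), ∏ i, (if b i then q else 1 - q)
      ≤ Real.exp (-(3 / 8)) := by
    calc _ ≤ ∑ b ∈ Finset.univ.filter (fun b => ¬ A b),
          Real.exp (-(m * ((1 + σ * ε) * p * k))) *
            ∏ i, (if b i then q * Real.exp m else 1 - q) := by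
          apply Finset.sum_le_sum
          intro b hb
          have hb' := hA b (by simpa using hb)
          have e1 : ∏ i, (if b i then q * Real.exp m else 1 - q) =
              (∏ i, (if b i then q else 1 - q)) *
              Real.exp (m * ((Finset.univ.filter fun i => b i = true).card : ℝ)) := by
            rw [rc_exp_card, ← Finset.prod_mul_distrib]
            apply Finset.prod_congr rfl
            intro i _
            split_ifs <;> simp
          rw [e1, mul_left_comm, ← Real.exp_add]
          apply le_mul_of_one_le_right (hW b)
          apply Real.one_le_exp
          rw [hm]
          nlinarith
      _ ≤ ∑ b : Fin k → Bool, Real.exp (-(m * ((1 + σ * ε) * p * k))) *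
            ∏ i, (if b i then q * Real.exp m else 1 - q) := by
          apply Finset.sum_le_sum_of_subset_of_nonneg (Finset.filter_subset _ _)
          intro b _ _
          apply mul_nonneg (Real.exp_pos _).le
          refine Finset.prod_nonneg fun i _ => ?_
          split_ifs
          · positivity
          · assumption
      _ = Real.exp (-(m * ((1 + σ * ε) * p * k))) * (q * Real.exp m + (1 - q)) ^ k := by
          rw [← Finset.mul_sum, rc_sum_prod]
      _ ≤ Real.exp (-(m * ((1 + σ * ε) * p * k))) * Real.exp (k * (q * (m + m ^ 2))) := by
          apply mul_le_mul_of_nonneg_left _ (Real.exp_pos _).le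
          rw [Real.exp_nat_mul]
          apply pow_le_pow_left₀ (by positivity)
          have hm1 : |m| ≤ 1 := by
            rw [hm, abs_le]
            rcases hσ with rfl | rfl <;> constructor <;> linarith
          have h1 := (abs_le.1 (Real.abs_exp_sub_one_sub_id_le hm1)).2
          have h2 := Real.add_one_le_exp (q * (m + m ^ 2))
          nlinarith [mul_le_mul_of_nonneg_left h1 hq0]
      _ ≤ _ := by
          rw [← Real.exp_add]
          apply Real.exp_le_exp.2
          have e : -(m * ((1 + σ * ε) * p * k)) + k * (q * (m + m ^ 2)) =
            - (ε ^ 2 * p * k) / 4 + ε ^ 2 / 16 * k * q := by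
            have hmm : m ^ 2 = ε ^ 2 / 16 := by rw [hm]; linear_combination (ε ^ 2 / 16) * hs2
            rw [hmm, hq, hm]; linear_combination (-ε ^ 2 * p * k / 4) * hs2
          rw [e]
          have := mul_le_mul_of_nonneg_left hq2 (by positivity : 0 ≤ ε ^ 2 / 16 * k)
          nlinarith
  have hexp : Real.exp (-(3 / 8)) ≤ 8 / 11 := by
    rw [Real.exp_neg, inv_le_comm₀ (Real.exp_pos _) (by norm_num)]
    have := Real.add_one_le_exp (3 / 8 : ℝ)
    linarith
  have htot := Finset.sum_filter_add_sum_filter_not Finset.univ A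
    (fun b : Fin k → Bool => ∏ i, (if b i then q else 1 - q))
  rw [rc_sum_prod] at htot
  have hone : q + (1 - q) = 1 := by ring
  rw [hone, one_pow] at htot
  have hQ : 3 / 11 ≤ ∑ b ∈ Finset.univ.filter A, ∏ i, (if b i then q else 1 - q) := by
    linarith
  -- Cauchy-Schwarz
  have hf : ∀ b : Fin k → Bool, 0 ≤ ∏ i, (if b i then p else 1 - p) := fun b =>
    Finset.prod_nonneg fun i _ => by split_ifs <;> linarith
  have hg : ∀ b : Fin k → Bool, 0 ≤ ∏ i, (if b i then q ^ 2 / p else (1 - q) ^ 2 / (1 - p)) :=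
    fun b => Finset.prod_nonneg fun i _ => by split_ifs <;> positivity
  have hcs := Finset.sum_sq_le_sum_mul_sum_of_sq_eq_mul (Finset.univ.filter A)
    (r := fun b : Fin k → Bool => ∏ i, (if b i then q else 1 - q))
    (fun b _ => hf b) (fun b _ => hg b) (by
      intro b _
      rw [← Finset.prod_pow, ← Finset.prod_mul_distrib]
      apply Finset.prod_congr rfl
      intro i _
      split_ifs <;> field_simp)
  have hG : ∑ b ∈ Finset.univ.filter A,
      ∏ i, (if b i then q ^ 2 / p else (1 - q) ^ 2 / (1 - p)) ≤
      Real.exp (8 * (ε ^ 2 * p * k)) := by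
    calc _ ≤ ∑ b : Fin k → Bool,
          ∏ i, (if b i then q ^ 2 / p else (1 - q) ^ 2 / (1 - p)) :=
          Finset.sum_le_sum_of_subset_of_nonneg (Finset.filter_subset _ _) fun b _ _ => hg b
      _ = (q ^ 2 / p + (1 - q) ^ 2 / (1 - p)) ^ k := rc_sum_prod _ _ _
      _ ≤ Real.exp (8 * (ε ^ 2 * p)) ^ k := by
          apply pow_le_pow_left₀ (by positivity)
          refine le_trans ?_ (Real.add_one_le_exp _)
          have e : q ^ 2 / p + (1 - q) ^ 2 / (1 - p) = 4 * ε ^ 2 * p / (1 - p) + 1 := by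
            rw [hq]; field_simp; linear_combination (4 * ε ^ 2 * p) * hs2
          rw [e]
          have : 4 * ε ^ 2 * p / (1 - p) ≤ 8 * (ε ^ 2 * p) := by
            rw [div_le_iff₀ hp3]
            nlinarith [mul_nonneg (sq_nonneg ε) hp1.le]
          linarith
      _ = _ := by rw [← Real.exp_nat_mul]; congr 1; ring
  set P := ∑ b ∈ Finset.univ.filter A, ∏ i, (if b i then p else 1 - p) with hP
  have hP0 : 0 ≤ P := Finset.sum_nonneg fun b _ => hf b
  have h1 : 9 / 121 ≤ P * Real.exp (8 * (ε ^ 2 * p * k)) := by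
    have := mul_le_mul_of_nonneg_left hG hP0
    nlinarith
  have h2 : Real.exp (-(ε ^ 2 * p * k)) ≤ 9 / 121 := by
    have h3 : Real.exp (-(ε ^ 2 * p * k)) ≤ Real.exp (-3) := Real.exp_le_exp.2 (by linarith)
    refine h3.trans ?_
    rw [Real.exp_neg, inv_le_comm₀ (Real.exp_pos _) (by norm_num)]
    have h4 : Real.exp 3 = Real.exp 1 ^ 3 := by rw [← Real.exp_nat_mul]; norm_num
    have h5 : (2.7 : ℝ) ^ 3 ≤ Real.exp 1 ^ 3 :=
      pow_le_pow_left₀ (by norm_num) (by linarith [Real.exp_one_gt_d9]) 3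
    rw [h4]
    refine le_trans ?_ h5
    norm_num
  have h6 : Real.exp (-(9 * ε ^ 2 * p * k)) * Real.exp (8 * (ε ^ 2 * p * k)) =
      Real.exp (-(ε ^ 2 * p * k)) := by
    rw [← Real.exp_add]; congr 1; ring
  exact le_of_mul_le_mul_right (by linarith) (Real.exp_pos (8 * (ε ^ 2 * p * k)))

/-- reverse Chernoff bound for binomial random variables. -/
theorem reverse_chernoff (k : ℕ) (hk : 1 ≤ k) (p ε : ℝ)
    (hp1 : 0 < p) (hp2 : p ≤ 1 / 2) (hε1 : 0 < ε) (hε2 : ε ≤ 1 / 2)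
    (h : 3 ≤ ε ^ 2 * p * k) :
    Real.exp (-(9 * ε ^ 2 * p * k)) ≤
      (∑ b ∈ Finset.univ.filter (fun b : Fin k → Bool =>
          ((Finset.univ.filter fun i => b i = true).card : ℝ) / k ≤ (1 - ε) * p),
        ∏ i, (if b i then p else 1 - p)) ∧
    Real.exp (-(9 * ε ^ 2 * p * k)) ≤
      (∑ b ∈ Finset.univ.filter (fun b : Fin k → Bool =>
          (1 + ε) * p ≤ ((Finset.univ.filter fun i => b i = true).card : ℝ) / k),
        ∏ i, (if b i then p else 1 - p)) := by
  have hk0 : (0 : ℝ) < k := by exact_mod_cast hk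
  constructor
  · apply rc_main k p ε (-1) (Or.inr rfl) hp1 hp2 hε1 hε2 h
    intro b hb
    rw [not_le, lt_div_iff₀ hk0] at hb
    linarith
  · apply rc_main k p ε 1 (Or.inl rfl) hp1 hp2 hε1 hε2 h
    intro b hb
    rw [not_le, div_lt_iff₀ hk0] at hb
    linarith

end
end
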